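/- Let P be a finite poset, M ⊆ P an antichain, and k ≥ 0. If dim(ΔP_{<m} * ΔP_{>m}) = dim ΔP_{<m} + dim ΔP_{>m} + 1 ≤ k for all m ∈ M, and the complex ΔP_{∉M} is k-connected (π₀(ΔP_{∉M}) = … = π_k(ΔP_{∉M}) = 0), then ΔP ≃ ΔP_{∉M} ∨ ⋁_{m∈M} Σ(ΔP_{<m} * ΔP_{>m}). -/

import Mathlib

/-- The geometric realization of the order complex of the subposet of `P` induced on `S`:
functions `P → ℝ` that are nonnegative, finitely supported, sum to `1`, and whose support is
a chain contained in `S`. Simplices are exactly the finite chains of `S`. -/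
def ocSet (P : Type) [Preorder P] (S : Set P) : Set (P → ℝ) :=
  {f | (∀ x, 0 ≤ f x) ∧ (Function.support f).Finite ∧ (∑ᶠ x, f x) = 1 ∧
    Function.support f ⊆ S ∧ IsChain (· ≤ ·) (Function.support f)}

/-- The order complex `Δ S` of the subposet induced on `S`, as a topological space. -/
abbrev ΔSp {P : Type} [Preorder P] (S : Set P) : Type := ↥(ocSet P S)

lemma ocSet_mono {P : Type} [Preorder P] {S T : Set P} (h : S ⊆ T) :
    ocSet P S ⊆ ocSet P T :=
  fun _ hf => ⟨hf.1, hf.2.1, hf.2.2.1, hf.2.2.2.1.trans h, hf.2.2.2.2⟩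

/-- The inclusion of order complexes induced by `S ⊆ T`. -/
def ΔIncl {P : Type} [Preorder P] {S T : Set P} (h : S ⊆ T) : C(ΔSp S, ΔSp T) :=
  ⟨Set.inclusion (ocSet_mono h), continuous_inclusion (ocSet_mono h)⟩
/-- The topological join `X * Y`: the double mapping cylinder of `X ← X × I × Y → Y`
(so that `X * ∅ = X` and `∅ * Y = Y`). -/
abbrev TopJoin (X Y : Type) [TopologicalSpace X] [TopologicalSpace Y] : Type :=
  Quot (fun a b : (X ⊕ (X × unitInterval × Y)) ⊕ Y =>
    (∃ x y, a = Sum.inl (Sum.inr (x, 0, y)) ∧ b = Sum.inl (Sum.inl x)) ∨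
    (∃ x y, a = Sum.inl (Sum.inr (x, 1, y)) ∧ b = Sum.inr y))

/-- The (unreduced) suspension `Σ X = S⁰ * X`. -/
abbrev Susp (X : Type) [TopologicalSpace X] : Type := TopJoin Bool X

/-- The wedge (one-point union) of two pointed spaces. -/
abbrev Wedge (X Y : Type) [TopologicalSpace X] [TopologicalSpace Y] (x0 : X) (y0 : Y) : Type :=
  Quot (fun a b : X ⊕ Y => a = Sum.inl x0 ∧ b = Sum.inr y0)

/-- The wedge of a family of pointed spaces (with an auxiliary base point glued to all the
base points of the family, so that the empty wedge is a one-point space). -/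
abbrev BigWedge {ι : Type} (X : ι → Type) [∀ i, TopologicalSpace (X i)] (pt : ∀ i, X i) : Type :=
  Quot (fun a b : (Σ i, X i) ⊕ Unit => (∃ i, a = Sum.inl ⟨i, pt i⟩) ∧ b = Sum.inr ())

/-- The base point of a wedge of a family. -/
def BigWedge.base {ι : Type} {X : ι → Type} [∀ i, TopologicalSpace (X i)] {pt : ∀ i, X i} :
    BigWedge X pt :=
  Quot.mk _ (Sum.inr ())
/-- The dimension (possibly `-1`, for the empty complex) of the order complex of the subposet
induced on `S`: one less than the maximal cardinality of a chain in `S`. -/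
noncomputable def chainDim {P : Type} [Preorder P] (S : Set P) : ℤ :=
  sSup ({-1} ∪ {d : ℤ | ∃ n : ℕ, d = n ∧ ∃ f : Fin (n + 1) → P, StrictMono f ∧ ∀ i, f i ∈ S})

section OrderComplex

open scoped unitInterval
open Topology

variable {P : Type}

/-- The point dividing the segment from `x` to `y` in the ratio `t : 1 - t`. -/
def segPt (x y : P → ℝ) (t : ℝ) : P → ℝ := fun p => (1 - t) * x p + t * y p

lemma segPt_zero (x y : P → ℝ) : segPt x y 0 = x := by ext; simp [segPt]

lemma segPt_one (x y : P → ℝ) : segPt x y 1 = y := by ext; simp [segPt]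

lemma continuous_segPt : Continuous fun q : (P → ℝ) × ℝ × (P → ℝ) => segPt q.1 q.2.2 q.2.1 := by
  unfold segPt
  fun_prop

/-- The total weight that `f` gives to `V`. -/
noncomputable def weight [Fintype P] (V : Set P) (f : P → ℝ) : ℝ := ∑ p, V.indicator f p

lemma weight_segPt [Fintype P] (V : Set P) (x y : P → ℝ) (t : ℝ) :
    weight V (segPt x y t) = (1 - t) * weight V x + t * weight V y := by
  classical
  simp only [weight, Finset.mul_sum, ← Finset.sum_add_distrib]
  refine Finset.sum_congr rfl fun p _ => ?_
  by_cases hp : p ∈ V <;> simp [hp, segPt]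

variable [PartialOrder P]

lemma mem_ocSet_iff [Fintype P] {S : Set P} {f : P → ℝ} :
    f ∈ ocSet P S ↔ (∀ x, 0 ≤ f x) ∧ ∑ x, f x = 1 ∧ (∀ x, x ∉ S → f x = 0) ∧
      ∀ x y, f x ≠ 0 → f y ≠ 0 → x ≤ y ∨ y ≤ x := by
  simp only [ocSet, Set.mem_ofPred_eq, finsum_eq_sum_of_fintype]
  refine ⟨fun ⟨h1, _, h2, h3, h4⟩ => ⟨h1, h2, fun x hx => ?_, fun x y hx hy => ?_⟩,
    fun ⟨h1, h2, h3, h4⟩ => ⟨h1, Set.toFinite _, h2, fun x hx => ?_, fun x hx y hy _ => ?_⟩⟩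
  · by_contra h
    exact hx (h3 h)
  · exact h4.total hx hy
  · by_contra h
    exact hx (h3 x h)
  · exact h4 x y hx hy

lemma isClosed_ocSet [Finite P] (S : Set P) : IsClosed (ocSet P S) := by
  have := Fintype.ofFinite P
  have h : ocSet P S = {f | ∀ x, 0 ≤ f x} ∩ ({f | ∑ x, f x = 1} ∩
      ({f | ∀ x, x ∉ S → f x = 0} ∩
        {f | ∀ x y, ¬ (x ≤ y ∨ y ≤ x) → f x * f y = 0})) := by
    ext f
    rw [mem_ocSet_iff]
    simp only [Set.mem_inter_iff, Set.mem_ofPred_eq, mul_eq_zero]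
    have : (∀ x y, f x ≠ 0 → f y ≠ 0 → x ≤ y ∨ y ≤ x) ↔
        ∀ x y, ¬ (x ≤ y ∨ y ≤ x) → f x = 0 ∨ f y = 0 :=
      forall₂_congr fun x y => by tauto
    rw [this]
  rw [h]
  refine IsClosed.inter ?_ (IsClosed.inter ?_ (IsClosed.inter ?_ ?_))
  · simp only [Set.ofPred_forall]
    exact isClosed_iInter fun x => isClosed_le continuous_const (continuous_apply x)
  · exact isClosed_eq (by fun_prop) continuous_const
  · simp only [Set.ofPred_forall]
    exact isClosed_iInter fun x => isClosed_iInter fun _ =>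
      isClosed_eq (continuous_apply x) continuous_const
  · simp only [Set.ofPred_forall]
    exact isClosed_iInter fun x => isClosed_iInter fun y => isClosed_iInter fun _ =>
      isClosed_eq (by fun_prop) continuous_const

instance compactSpace_ΔSp [Finite P] (S : Set P) : CompactSpace (ΔSp S) := by
  have := Fintype.ofFinite P
  rw [← isCompact_iff_compactSpace]
  refine (isCompact_Icc (a := (0 : P → ℝ)) (b := 1)).of_isClosed_subset (isClosed_ocSet S) ?_
  intro f hf
  rw [mem_ocSet_iff] at hf
  refine ⟨hf.1, fun x => ?_⟩
  rw [Pi.one_apply, ← hf.2.1]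
  exact Finset.single_le_sum (fun i _ => hf.1 i) (Finset.mem_univ x)

lemma segPt_mem [Finite P] {U V W : Set P} (hU : U ⊆ W) (hV : V ⊆ W)
    (hUV : ∀ u ∈ U, ∀ v ∈ V, u ≤ v ∨ v ≤ u) {x y : P → ℝ} (hx : x ∈ ocSet P U)
    (hy : y ∈ ocSet P V) (t : I) : segPt x y t ∈ ocSet P W := by
  have := Fintype.ofFinite P
  rw [mem_ocSet_iff] at hx hy ⊢
  obtain ⟨x1, x2, x3, x4⟩ := hx
  obtain ⟨y1, y2, y3, y4⟩ := hy
  have ht := t.2.1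
  have ht' : (0 : ℝ) ≤ 1 - t := sub_nonneg.2 t.2.2
  refine ⟨fun p => add_nonneg (mul_nonneg ht' (x1 p)) (mul_nonneg ht (y1 p)), ?_, ?_, ?_⟩
  · simp [segPt, Finset.sum_add_distrib, ← Finset.mul_sum, x2, y2]
  · intro p hp
    simp [segPt, x3 p fun h => hp (hU h), y3 p fun h => hp (hV h)]
  · have key : ∀ p, segPt x y t p ≠ 0 → x p ≠ 0 ∨ y p ≠ 0 := by
      intro p hp
      by_contra! h
      exact hp (by simp [segPt, h.1, h.2])
    have hxU : ∀ p, x p ≠ 0 → p ∈ U := fun p hp => by_contra fun h => hp (x3 p h)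
    have hyV : ∀ p, y p ≠ 0 → p ∈ V := fun p hp => by_contra fun h => hp (y3 p h)
    intro p q hp hq
    rcases key p hp with hp | hp <;> rcases key q hq with hq | hq
    · exact x4 p q hp hq
    · exact hUV p (hxU p hp) q (hyV q hq)
    · exact (hUV q (hxU q hq) p (hyV p hp)).symm
    · exact y4 p q hp hq

lemma ocSet_eq_zero {S : Set P} {f : P → ℝ} (hf : f ∈ ocSet P S) {p : P} (hp : p ∉ S) :
    f p = 0 := by
  by_contra h
  exact hp (hf.2.2.2.1 h)

lemma mem_ocSet_of_eq_zero {S T : Set P} {f : P → ℝ} (hf : f ∈ ocSet P S)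
    (h : ∀ p ∈ S, p ∉ T → f p = 0) : f ∈ ocSet P T := by
  refine ⟨hf.1, hf.2.1, hf.2.2.1, fun p hp => ?_, hf.2.2.2.2⟩
  by_contra hT
  exact hp (h p (hf.2.2.2.1 hp) hT)

lemma weight_self [Fintype P] {V : Set P} {f : P → ℝ} (hf : f ∈ ocSet P V) : weight V f = 1 := by
  rw [← (mem_ocSet_iff.1 hf).2.1]
  refine Finset.sum_congr rfl fun p _ => ?_
  by_cases hp : p ∈ V
  · simp [hp]
  · simp [hp, ocSet_eq_zero hf hp]

lemma weight_of_disjoint [Fintype P] {U V : Set P} (hUV : Disjoint U V) {f : P → ℝ}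
    (hf : f ∈ ocSet P U) : weight V f = 0 := by
  refine Finset.sum_eq_zero fun p _ => ?_
  by_cases hp : p ∈ V
  · simp [hp, ocSet_eq_zero hf (hUV.notMem_of_mem_right hp)]
  · simp [hp]

lemma weight_segPt_of_disjoint [Fintype P] {U V : Set P} (hUV : Disjoint U V) {x y : P → ℝ}
    (hx : x ∈ ocSet P U) (hy : y ∈ ocSet P V) (t : ℝ) : weight V (segPt x y t) = t := by
  rw [weight_segPt, weight_of_disjoint hUV hx, weight_self hy]
  ring

lemma segPt_injective [Finite P] {U V : Set P} (hUV : Disjoint U V) {x y x' y' : P → ℝ}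
    (hx : x ∈ ocSet P U) (hy : y ∈ ocSet P V) (hx' : x' ∈ ocSet P U) (hy' : y' ∈ ocSet P V)
    {t t' : ℝ} (h : segPt x y t = segPt x' y' t') :
    t = t' ∧ (t ≠ 1 → x = x') ∧ (t ≠ 0 → y = y') := by
  have := Fintype.ofFinite P
  have ht : t = t' := by
    rw [← weight_segPt_of_disjoint hUV hx hy t, h, weight_segPt_of_disjoint hUV hx' hy' t']
  subst ht
  refine ⟨rfl, fun ht => ?_, fun ht => ?_⟩
  · ext p
    have hp := congrFun h p
    by_cases hpU : p ∈ U
    · have hpV := hUV.notMem_of_mem_left hpU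
      simp only [segPt, ocSet_eq_zero hy hpV, ocSet_eq_zero hy' hpV, mul_zero, add_zero] at hp
      exact mul_left_cancel₀ (sub_ne_zero.2 ht.symm) hp
    · rw [ocSet_eq_zero hx hpU, ocSet_eq_zero hx' hpU]
  · ext p
    have hp := congrFun h p
    by_cases hpV : p ∈ V
    · have hpU := hUV.notMem_of_mem_right hpV
      simp only [segPt, ocSet_eq_zero hx hpU, ocSet_eq_zero hx' hpU, mul_zero, zero_add] at hp
      exact mul_left_cancel₀ ht hp
    · rw [ocSet_eq_zero hy hpV, ocSet_eq_zero hy' hpV]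

lemma inv_smul_indicator_mem [Fintype P] {S V : Set P} {f : P → ℝ} (hf : f ∈ ocSet P S)
    (h : weight V f ≠ 0) : (fun p => (weight V f)⁻¹ * V.indicator f p) ∈ ocSet P (V ∩ S) := by
  rw [mem_ocSet_iff] at hf ⊢
  obtain ⟨f1, f2, f3, f4⟩ := hf
  have hnn : ∀ p, 0 ≤ V.indicator f p := Set.indicator_nonneg fun p _ => f1 p
  refine ⟨fun p => mul_nonneg (inv_nonneg.2 (Finset.sum_nonneg fun p _ => hnn p)) (hnn p),
    ?_, ?_, ?_⟩
  · rw [← Finset.mul_sum]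
    exact inv_mul_cancel₀ h
  · intro p hp
    by_cases hpV : p ∈ V
    · simp [f3 p fun hS => hp ⟨hpV, hS⟩]
    · simp [hpV]
  · intro p q hp hq
    refine f4 p q ?_ ?_
    · rintro h0
      exact hp (by simp [h0])
    · rintro h0
      exact hq (by simp [h0])

lemma weight_add_weight_compl [Fintype P] {S : Set P} {f : P → ℝ} (hf : f ∈ ocSet P S)
    (V : Set P) : weight Vᶜ f + weight V f = 1 := by
  rw [weight, weight, ← Finset.sum_add_distrib, ← (mem_ocSet_iff.1 hf).2.1]
  exact Finset.sum_congr rfl fun p _ => congrFun (Set.indicator_compl_add_self V f) p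

lemma weight_nonneg [Fintype P] {S : Set P} {f : P → ℝ} (hf : f ∈ ocSet P S)
    (V : Set P) : 0 ≤ weight V f :=
  Finset.sum_nonneg fun _ _ => Set.indicator_nonneg (fun p _ => hf.1 p) _

lemma eq_zero_of_weight_eq_zero [Fintype P] {S V : Set P} {f : P → ℝ} (hf : f ∈ ocSet P S)
    (h : weight V f = 0) {p : P} (hp : p ∈ V) : f p = 0 := by
  have := (Finset.sum_eq_zero_iff_of_nonneg
    fun q _ => Set.indicator_nonneg (fun p _ => hf.1 p) q).1 h p (Finset.mem_univ p)
  simpa [hp] using this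

/-- Every point of the order complex of `S` either lies over `S \ V` or over `V`, or lies strictly
between two such points. -/
lemma exists_segPt [Finite P] {S : Set P} {f : P → ℝ} (hf : f ∈ ocSet P S) (V : Set P) :
    f ∈ ocSet P (Vᶜ ∩ S) ∨ f ∈ ocSet P (V ∩ S) ∨
      ∃ x ∈ ocSet P (Vᶜ ∩ S), ∃ y ∈ ocSet P (V ∩ S), ∃ t : I, f = segPt x y t ∧
        Function.support x ⊆ Function.support f ∧ Function.support y ⊆ Function.support f := by
  have := Fintype.ofFinite P
  have h1 := weight_add_weight_compl hf V
  by_cases hV : weight V f = 0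
  · left
    refine mem_ocSet_of_eq_zero hf fun p hp hpT => eq_zero_of_weight_eq_zero hf hV ?_
    by_contra h
    exact hpT ⟨h, hp⟩
  by_cases hV' : weight Vᶜ f = 0
  · right; left
    refine mem_ocSet_of_eq_zero hf fun p hp hpT => eq_zero_of_weight_eq_zero hf hV' ?_
    intro h
    exact hpT ⟨h, hp⟩
  right; right
  refine ⟨_, inv_smul_indicator_mem hf hV', _, inv_smul_indicator_mem hf hV,
    ⟨weight V f, weight_nonneg hf V, by linarith [weight_nonneg hf Vᶜ]⟩, ?_, ?_, ?_⟩
  · ext p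
    simp only [segPt, ← h1, add_sub_cancel_right, mul_inv_cancel_left₀ hV,
      mul_inv_cancel_left₀ hV']
    exact (congrFun (Set.indicator_compl_add_self V f) p).symm
  · intro p hp h0
    exact hp (by simp [h0])
  · intro p hp h0
    exact hp (by simp [h0])

section Join

variable [Finite P] {U V : Set P} (hUV : ∀ u ∈ U, ∀ v ∈ V, u < v)

/-- The canonical map from the join of the order complexes of `U` and `V` to the order complex of
`U ∪ V`, when `U` lies below `V`. -/
noncomputable def joinMap : TopJoin (ΔSp U) (ΔSp V) → ΔSp (U ∪ V) :=
  Quot.lift (Sum.elim (Sum.elim (ΔIncl Set.subset_union_left)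
      (fun q => ⟨segPt q.1 q.2.2 q.2.1, segPt_mem Set.subset_union_left Set.subset_union_right
        (fun u hu v hv => .inl (hUV u hu v hv).le) q.1.2 q.2.2.2 q.2.1⟩))
      (ΔIncl Set.subset_union_right)) <| by
    rintro a b (⟨x, y, rfl, rfl⟩ | ⟨x, y, rfl, rfl⟩)
    · exact Subtype.ext (segPt_zero _ _)
    · exact Subtype.ext (segPt_one _ _)

lemma continuous_joinMap : Continuous (joinMap hUV) := by
  refine continuous_quot_lift _ (.sumElim (.sumElim (ΔIncl _).continuous ?_) (ΔIncl _).continuous)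
  exact Continuous.subtype_mk (continuous_segPt.comp
    (f := fun q : ΔSp U × I × ΔSp V => ((q.1 : P → ℝ), (q.2.1 : ℝ), (q.2.2 : P → ℝ)))
    (by fun_prop)) _

lemma joinMap_bijective : Function.Bijective (joinMap hUV) := by
  have := Fintype.ofFinite P
  have hd : Disjoint U V := Set.disjoint_left.2 fun p hp hp' => (hUV p hp p hp').false
  constructor
  · have w0 (x : ΔSp U) : weight V (x : P → ℝ) = 0 := weight_of_disjoint hd x.2
    have w1 (y : ΔSp V) : weight V (y : P → ℝ) = 1 := weight_self y.2
    have wt (x : ΔSp U) (t : I) (y : ΔSp V) : weight V (segPt x y t) = t :=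
      weight_segPt_of_disjoint hd x.2 y.2 t
    have s0 (x : ΔSp U) (t : I) (y : ΔSp V) (h : (t : ℝ) = 0) :
        (Quot.mk _ (.inl (.inr (x, t, y))) : TopJoin (ΔSp U) (ΔSp V)) =
          Quot.mk _ (.inl (.inl x)) := by
      obtain rfl : t = 0 := Subtype.ext h
      exact Quot.sound (.inl ⟨x, y, rfl, rfl⟩)
    have s1 (x : ΔSp U) (t : I) (y : ΔSp V) (h : (t : ℝ) = 1) :
        (Quot.mk _ (.inl (.inr (x, t, y))) : TopJoin (ΔSp U) (ΔSp V)) =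
          Quot.mk _ (.inr y) := by
      obtain rfl : t = 1 := Subtype.ext h
      exact Quot.sound (.inr ⟨x, y, rfl, rfl⟩)
    rintro ⟨(x | ⟨x, t, y⟩) | y⟩ ⟨(x' | ⟨x', t', y'⟩) | y'⟩ h <;>
      have h := congrArg Subtype.val h
    · obtain rfl : x = x' := Subtype.ext h
      rfl
    · have hw : (t' : ℝ) = 0 := by rw [← wt x' t' y', ← w0 x]; exact congrArg _ h.symm
      rw [s0 _ _ _ hw]
      obtain rfl : x = x' := Subtype.ext (h.trans (by simp [joinMap, hw, segPt_zero]))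
      rfl
    · exact absurd ((w0 x).symm.trans ((congrArg _ h).trans (w1 y'))) zero_ne_one
    · have hw : (t : ℝ) = 0 := by rw [← wt x t y, ← w0 x']; exact congrArg _ h
      rw [s0 _ _ _ hw]
      obtain rfl : x' = x := Subtype.ext (h.symm.trans (by simp [joinMap, hw, segPt_zero]))
      rfl
    · obtain ⟨ht, hx, hy⟩ := segPt_injective hd x.2 y.2 x'.2 y'.2 h
      obtain rfl : t = t' := Subtype.ext ht
      by_cases h1 : (t : ℝ) = 1
      · rw [s1 _ _ _ h1, s1 _ _ _ h1, Subtype.ext (hy (by simp [h1]))]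
      · obtain rfl := Subtype.ext (hx h1)
        by_cases h0 : (t : ℝ) = 0
        · rw [s0 _ _ _ h0, s0 _ _ _ h0]
        · rw [Subtype.ext (hy h0)]
    · have hw : (t : ℝ) = 1 := by rw [← wt x t y, ← w1 y']; exact congrArg _ h
      rw [s1 _ _ _ hw]
      obtain rfl : y' = y := Subtype.ext (h.symm.trans (by simp [joinMap, hw, segPt_one]))
      rfl
    · exact absurd ((w0 x').symm.trans ((congrArg _ h.symm).trans (w1 y))) zero_ne_one
    · have hw : (t' : ℝ) = 1 := by rw [← wt x' t' y', ← w1 y]; exact congrArg _ h.symm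
      rw [s1 _ _ _ hw]
      obtain rfl : y = y' := Subtype.ext (h.trans (by simp [joinMap, hw, segPt_one]))
      rfl
    · obtain rfl : y = y' := Subtype.ext h
      rfl
  · intro f
    have hU : Vᶜ ∩ (U ∪ V) = U := by
      rw [Set.inter_union_distrib_left, Set.compl_inter_self, Set.union_empty,
        Set.inter_eq_right]
      exact hd.subset_compl_right
    have hV : V ∩ (U ∪ V) = V := Set.inter_eq_left.2 Set.subset_union_right
    rcases exists_segPt f.2 V with h | h | ⟨x, hx, y, hy, t, h, -, -⟩
    · exact ⟨Quot.mk _ (.inl (.inl ⟨f, ocSet_mono hU.subset h⟩)), rfl⟩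
    · exact ⟨Quot.mk _ (.inr ⟨f, ocSet_mono hV.subset h⟩), rfl⟩
    · exact ⟨Quot.mk _ (.inl (.inr (⟨x, ocSet_mono hU.subset hx⟩, t,
        ⟨y, ocSet_mono hV.subset hy⟩))), Subtype.ext h.symm⟩

/-- The order complex of `U ∪ V` is the join of the order complexes of `U` and `V`, when `U` lies
below `V`. -/
noncomputable def joinHomeomorph : TopJoin (ΔSp U) (ΔSp V) ≃ₜ ΔSp (U ∪ V) :=
  (continuous_joinMap hUV).homeoOfEquivCompactToT2
    (f := Equiv.ofBijective (joinMap hUV) (joinMap_bijective hUV))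

end Join

end OrderComplex

section MultiCone

open scoped unitInterval
open Topology

/-- The gluing relation for the cones over a family of maps. -/
inductive MultiConeRel {ι A : Type} {J : ι → Type} (f : ∀ i, J i → A) :
    A ⊕ (Σ i, (J i × I) ⊕ Unit) → A ⊕ (Σ i, (J i × I) ⊕ Unit) → Prop
  | bot (i : ι) (j : J i) : MultiConeRel f (.inr ⟨i, .inl (j, 0)⟩) (.inl (f i j))
  | top (i : ι) (j : J i) : MultiConeRel f (.inr ⟨i, .inl (j, 1)⟩) (.inr ⟨i, .inr ()⟩)

/-- The space obtained from `A` by attaching, for every `i`, a cone over `J i` along `f i`. -/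
abbrev MultiCone {ι A : Type} [TopologicalSpace A] {J : ι → Type} [∀ i, TopologicalSpace (J i)]
    (f : ∀ i, J i → A) : Type :=
  Quot (MultiConeRel f)

namespace MultiCone

variable {ι A : Type} [TopologicalSpace A] {J : ι → Type} [∀ i, TopologicalSpace (J i)]
  (f : ∀ i, J i → A)

/-- The inclusion of the space to which the cones are attached. -/
def base : C(A, MultiCone f) where
  toFun a := Quot.mk _ (.inl a)
  continuous_toFun := continuous_quot_mk.comp continuous_inl

/-- The cylinder over `J i`. -/
def cyl (i : ι) : C(J i × I, MultiCone f) where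
  toFun q := Quot.mk _ (.inr ⟨i, .inl q⟩)
  continuous_toFun :=
    continuous_quot_mk.comp (continuous_inr.comp (continuous_sigmaMk.comp continuous_inl))

/-- The apex of the `i`-th cone. -/
def apex (i : ι) : MultiCone f := Quot.mk _ (.inr ⟨i, .inr ()⟩)

lemma cyl_zero (i : ι) (j : J i) : cyl f i (j, 0) = base f (f i j) := Quot.sound (.bot i j)

lemma cyl_one (i : ι) (j : J i) : cyl f i (j, 1) = apex f i := Quot.sound (.top i j)

variable {f}

lemma ind {p : MultiCone f → Prop} (hb : ∀ a, p (base f a)) (hc : ∀ i j t, p (cyl f i (j, t)))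
    (ha : ∀ i, p (apex f i)) (z : MultiCone f) : p z := by
  rcases z with ⟨a | ⟨i, ⟨j, t⟩ | ⟨⟩⟩⟩
  exacts [hb a, hc i j t, ha i]

variable {Y : Type} [TopologicalSpace Y]

/-- The map out of an attached family of cones given by compatible maps on the pieces. -/
def lift (b : C(A, Y)) (c : ∀ i, C(J i × I, Y)) (y : ι → Y)
    (h0 : ∀ i j, c i (j, 0) = b (f i j)) (h1 : ∀ i j, c i (j, 1) = y i) : C(MultiCone f, Y) where
  toFun := Quot.lift (Sum.elim b fun s => Sum.elim (c s.1) (fun _ => y s.1) s.2) <| by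
    rintro _ _ (⟨i, j⟩ | ⟨i, j⟩)
    · exact h0 i j
    · exact h1 i j
  continuous_toFun := by
    refine continuous_quot_lift _ (.sumElim b.continuous (continuous_sigma fun i => ?_))
    have h : Continuous (Sum.elim (c i) fun _ : Unit => y i) :=
      (c i).continuous.sumElim continuous_const
    exact h

section lift

variable (b : C(A, Y)) (c : ∀ i, C(J i × I, Y)) (y : ι → Y)
    (h0 : ∀ i j, c i (j, 0) = b (f i j)) (h1 : ∀ i j, c i (j, 1) = y i)

@[simp] lemma lift_base (a : A) : lift b c y h0 h1 (base f a) = b a := rfl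

@[simp] lemma lift_cyl (i : ι) (q : J i × I) : lift b c y h0 h1 (cyl f i q) = c i q := rfl

@[simp] lemma lift_apex (i : ι) : lift b c y h0 h1 (apex f i) = y i := rfl

end lift

/-- A map from `MultiCone f × Z` is given by compatible maps on the pieces. -/
lemma exists_lift_prod {Z : Type} [TopologicalSpace Z] [LocallyCompactSpace Z]
    (b : C(A × Z, Y)) (c : ∀ i, C((J i × I) × Z, Y)) (y : ∀ _ : ι, C(Z, Y))
    (h0 : ∀ i j z, c i ((j, 0), z) = b (f i j, z)) (h1 : ∀ i j z, c i ((j, 1), z) = y i z) :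
    ∃ F : C(MultiCone f × Z, Y), (∀ a z, F (base f a, z) = b (a, z)) ∧
      (∀ i q z, F (cyl f i q, z) = c i (q, z)) ∧ ∀ i z, F (apex f i, z) = y i z :=
  ⟨(lift b.curry (fun i => (c i).curry) y (fun i j => ContinuousMap.ext (h0 i j))
    fun i j => ContinuousMap.ext (h1 i j)).uncurry, fun _ _ => rfl, fun _ _ _ => rfl,
    fun _ _ => rfl⟩

end MultiCone

end MultiCone

section OrderComplexCone

open scoped unitInterval
open Topology

variable {P : Type} [PartialOrder P]

/-- `S` is obtained from `R` by adding the antichain `a`, and `L i` is the link of `a i`. -/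
structure AntichainExtension {ι : Type} (a : ι → P) (R S : Set P) (L : ι → Set P) : Prop where
  mem : ∀ i, a i ∈ S
  not_le : ∀ i i', i ≠ i' → ¬ a i ≤ a i'
  eq_diff : R = S \ Set.range a
  link_eq : ∀ i, L i = S ∩ (Set.Iio (a i) ∪ Set.Ioi (a i))

namespace AntichainExtension

variable {ι : Type} {a : ι → P} {R S : Set P} {L : ι → Set P}

lemma subset (h : AntichainExtension a R S L) : R ⊆ S := h.eq_diff ▸ Set.sdiff_subset

lemma injective (h : AntichainExtension a R S L) : Function.Injective a := fun i i' hi => by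
  by_contra hne
  exact h.not_le i i' hne hi.le

lemma notMem_link (h : AntichainExtension a R S L) (i i' : ι) : a i ∉ L i' := by
  rw [h.link_eq]
  rintro ⟨-, hi | hi⟩
  · exact h.not_le i i' (fun h => by simp [h] at hi) (le_of_lt hi)
  · exact h.not_le i' i (fun h => by simp [h] at hi) (le_of_lt hi)

lemma notMem (h : AntichainExtension a R S L) (i : ι) : a i ∉ R := by simp [h.eq_diff]

lemma link_subset' (h : AntichainExtension a R S L) (i : ι) : L i ⊆ S := by
  rw [h.link_eq]
  exact Set.inter_subset_left

lemma link_subset (h : AntichainExtension a R S L) (i : ι) : L i ⊆ R := by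
  intro p hp
  rw [h.eq_diff]
  refine ⟨h.link_subset' i hp, ?_⟩
  rintro ⟨i', rfl⟩
  exact h.notMem_link i' i hp

lemma comparable (h : AntichainExtension a R S L) (i : ι) (u : P) (hu : u ∈ L i)
    (v : P) (hv : v ∈ ({a i} : Set P)) : u ≤ v ∨ v ≤ u := by
  obtain rfl := hv
  rw [h.link_eq] at hu
  exact hu.2.imp le_of_lt le_of_lt

end AntichainExtension

variable [Finite P]

open Classical in
lemma single_mem_ocSet (p : P) : Pi.single p (1 : ℝ) ∈ ocSet P {p} := by
  have := Fintype.ofFinite P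
  rw [mem_ocSet_iff]
  have key : ∀ x, (Pi.single p (1 : ℝ) : P → ℝ) x ≠ 0 → x = p := by
    intro x hx
    by_contra h
    exact hx (Pi.single_eq_of_ne h 1)
  refine ⟨fun x => ?_, by simp, fun x hx => Pi.single_eq_of_ne hx 1, fun x y hx hy => ?_⟩
  · rcases eq_or_ne x p with rfl | h
    · simp
    · rw [Pi.single_eq_of_ne h]
  · rw [key x hx, key y hy]
    exact .inl le_rfl

open Classical in
/-- The vertex `p` of the order complex of a set containing `p`. -/
noncomputable def ocVertex {S : Set P} {p : P} (hp : p ∈ S) : ΔSp S :=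
  ⟨Pi.single p 1, ocSet_mono (Set.singleton_subset_iff.2 hp) (single_mem_ocSet p)⟩

lemma ocVertex_apply_self {S : Set P} {p : P} (hp : p ∈ S) : (ocVertex hp : P → ℝ) p = 1 := by
  simp [ocVertex]

lemma ocVertex_apply_of_ne {S : Set P} {p x : P} (hp : p ∈ S) (h : x ≠ p) :
    (ocVertex hp : P → ℝ) x = 0 := by
  simp [ocVertex, h]

lemma ocVertex_mem {S : Set P} {p : P} (hp : p ∈ S) : (ocVertex hp : P → ℝ) ∈ ocSet P {p} :=
  single_mem_ocSet p

lemma eq_ocVertex {S : Set P} {p : P} (hp : p ∈ S) {f : P → ℝ} (hf : f ∈ ocSet P {p}) :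
    f = ocVertex hp := by
  have := Fintype.ofFinite P
  obtain ⟨-, h1, h0, -⟩ := mem_ocSet_iff.1 hf
  have h1 : f p = 1 := by
    rw [← h1]
    exact (Finset.sum_eq_single p (fun q _ hq => h0 q hq) (by simp)).symm
  ext x
  rcases eq_or_ne x p with rfl | h
  · rw [h1, ocVertex_apply_self]
  · rw [h0 x h, ocVertex_apply_of_ne hp h]

namespace AntichainExtension

variable {ι : Type} {a : ι → P} {R S : Set P} {L : ι → Set P} (h : AntichainExtension a R S L)
  {J : ι → Type} [∀ i, TopologicalSpace (J i)] (e : ∀ i, J i ≃ₜ ΔSp (L i))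

/-- The attaching maps of the cones over the links. -/
def attach (i : ι) : C(J i, ΔSp R) := (ΔIncl (h.link_subset i)).comp (e i)

/-- The map from the order complex of `R` with cones attached to the order complex of `S`. -/
noncomputable def coneMap : C(MultiCone fun i => h.attach e i, ΔSp S) :=
  MultiCone.lift (ΔIncl h.subset)
    (fun i =>
      { toFun q := ⟨segPt (e i q.1) (ocVertex (h.mem i)) q.2, segPt_mem (h.link_subset' i)
          (Set.singleton_subset_iff.2 (h.mem i)) (h.comparable i) (e i q.1).2
            (ocVertex_mem (h.mem i)) q.2⟩
        continuous_toFun := Continuous.subtype_mk (continuous_segPt.comp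
          (f := fun q : J i × I => ((e i q.1 : P → ℝ), (q.2 : ℝ), (ocVertex (h.mem i) : P → ℝ)))
            (by fun_prop)) _ })
    (fun i => ocVertex (h.mem i))
    (fun _ _ => Subtype.ext (segPt_zero _ _)) (fun _ _ => Subtype.ext (segPt_one _ _))

lemma coneMap_cyl (i : ι) (j : J i) (t : I) :
    (h.coneMap e (MultiCone.cyl _ i (j, t)) : P → ℝ) =
      segPt (e i j) (ocVertex (h.mem i)) t := rfl

lemma segPt_link_apply (i i' : ι) (x : ΔSp (L i)) (t : ℝ) :
    segPt x (ocVertex (h.mem i)) t (a i') = t * (ocVertex (h.mem i) : P → ℝ) (a i') := by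
  simp [segPt, ocSet_eq_zero x.2 (h.notMem_link i' i)]

lemma segPt_link_apply_self (i : ι) (x : ΔSp (L i)) (t : ℝ) :
    segPt x (ocVertex (h.mem i)) t (a i) = t := by
  rw [h.segPt_link_apply, ocVertex_apply_self, mul_one]

lemma segPt_link_apply_of_ne {i i' : ι} (hi : i' ≠ i) (x : ΔSp (L i)) (t : ℝ) :
    segPt x (ocVertex (h.mem i)) t (a i') = 0 := by
  rw [h.segPt_link_apply, ocVertex_apply_of_ne _ (h.injective.ne hi), mul_zero]

lemma coneMap_bijective : Function.Bijective (h.coneMap e) := by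
  have := Fintype.ofFinite P
  constructor
  · have s0 (i : ι) (j : J i) (t : I) (ht : (t : ℝ) = 0) :
        MultiCone.cyl (fun i => h.attach e i) i (j, t) = MultiCone.base _ (h.attach e i j) := by
      obtain rfl : t = 0 := Subtype.ext ht
      exact MultiCone.cyl_zero _ i j
    have s1 (i : ι) (j : J i) (t : I) (ht : (t : ℝ) = 1) :
        MultiCone.cyl (fun i => h.attach e i) i (j, t) = MultiCone.apex _ i := by
      obtain rfl : t = 1 := Subtype.ext ht
      exact MultiCone.cyl_one _ i j
    have z (x : ΔSp R) (i : ι) : (x : P → ℝ) (a i) = 0 := ocSet_eq_zero x.2 (h.notMem i)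
    have base_cyl (x : ΔSp R) (i : ι) (j : J i) (t : I)
        (hx : h.coneMap e (MultiCone.base _ x) = h.coneMap e (MultiCone.cyl _ i (j, t))) :
        MultiCone.base (fun i => h.attach e i) x = MultiCone.cyl _ i (j, t) := by
      have hx : (x : P → ℝ) = segPt (e i j) (ocVertex (h.mem i)) t := congrArg Subtype.val hx
      have ht : (t : ℝ) = 0 := by rw [← h.segPt_link_apply_self i (e i j) t, ← hx, z]
      rw [s0 _ _ _ ht]
      congr 1
      exact Subtype.ext (hx.trans (by rw [ht, segPt_zero]; rfl))
    have base_apex (x : ΔSp R) (i : ι)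
        (hx : h.coneMap e (MultiCone.base _ x) = h.coneMap e (MultiCone.apex _ i)) : False := by
      have hx : (x : P → ℝ) = ocVertex (h.mem i) := congrArg Subtype.val hx
      have := z x i
      rw [hx, ocVertex_apply_self] at this
      exact one_ne_zero this
    have apex_cyl (i' : ι) (i : ι) (j : J i) (t : I)
        (hx : h.coneMap e (MultiCone.apex _ i') = h.coneMap e (MultiCone.cyl _ i (j, t))) :
        MultiCone.apex (fun i => h.attach e i) i' = MultiCone.cyl _ i (j, t) := by
      have hx : (ocVertex (h.mem i') : P → ℝ) = segPt (e i j) (ocVertex (h.mem i)) t :=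
        congrArg Subtype.val hx
      obtain rfl : i' = i := by
        by_contra hne
        have := h.segPt_link_apply_of_ne hne (e i j) t
        rw [← hx, ocVertex_apply_self] at this
        exact one_ne_zero this
      refine (s1 _ _ _ ?_).symm
      rw [← h.segPt_link_apply_self i' (e i' j) t, ← hx, ocVertex_apply_self]
    intro z z'
    induction z using MultiCone.ind with
    | hb x =>
      induction z' using MultiCone.ind with
      | hb x' =>
        intro hx
        congr 1
        exact Subtype.ext (congrArg Subtype.val hx :)
      | hc i j t => exact base_cyl x i j t
      | ha i => exact fun hx => (base_apex x i hx).elim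
    | hc i j t =>
      induction z' using MultiCone.ind with
      | hb x => exact fun hx => (base_cyl x i j t hx.symm).symm
      | hc i' j' t' =>
        intro hx
        have hx : segPt (e i j : P → ℝ) (ocVertex (h.mem i)) t =
          segPt (e i' j') (ocVertex (h.mem i')) t' := congrArg Subtype.val hx
        by_cases hi : i = i'
        · subst hi
          obtain ⟨ht, hj, -⟩ := segPt_injective
            (Set.disjoint_singleton_right.2 (h.notMem_link i i)) (e i j).2 (ocVertex_mem (h.mem i))
            (e i j').2 (ocVertex_mem (h.mem i)) hx
          obtain rfl : t = t' := Subtype.ext ht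
          by_cases h1 : (t : ℝ) = 1
          · rw [s1 _ _ _ h1, s1 _ _ _ h1]
          · rw [(e i).injective (Subtype.ext (hj h1))]
        · have ht : (t : ℝ) = 0 := by
            rw [← h.segPt_link_apply_self i (e i j) t, hx, h.segPt_link_apply_of_ne hi]
          have ht' : (t' : ℝ) = 0 := by
            rw [← h.segPt_link_apply_self i' (e i' j') t', ← hx,
              h.segPt_link_apply_of_ne (Ne.symm hi)]
          rw [s0 _ _ _ ht, s0 _ _ _ ht']
          congr 1
          rw [ht, ht', segPt_zero, segPt_zero] at hx
          exact Subtype.ext hx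
      | ha i' => exact fun hx => (apex_cyl i' i j t hx.symm).symm
    | ha i =>
      induction z' using MultiCone.ind with
      | hb x => exact fun hx => (base_apex x i hx.symm).elim
      | hc i' j t => exact apex_cyl i i' j t
      | ha i' =>
        intro hx
        have hx : (ocVertex (h.mem i) : P → ℝ) = ocVertex (h.mem i') := congrArg Subtype.val hx
        obtain rfl : i = i' := by
          by_contra hne
          have := ocVertex_apply_self (h.mem i)
          rw [hx, ocVertex_apply_of_ne _ (h.injective.ne hne)] at this
          exact zero_ne_one this
        rfl
  · rintro ⟨f, hf⟩
    by_cases hfa : ∃ i, f (a i) ≠ 0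
    · obtain ⟨i, hi⟩ := hfa
      rcases exists_segPt hf {a i} with h' | h' | ⟨x, hx, y, hy, t, hfx, hxf, -⟩
      · exact absurd (ocSet_eq_zero h' (by simp)) hi
      · exact ⟨MultiCone.apex _ i,
          Subtype.ext (eq_ocVertex (h.mem i) (ocSet_mono Set.inter_subset_left h')).symm⟩
      · have hxL : x ∈ ocSet P (L i) := by
          refine mem_ocSet_of_eq_zero hx fun p hp hpL => ?_
          by_contra hxp
          refine hpL ?_
          rw [h.link_eq]
          refine ⟨hp.2, ?_⟩
          exact ((mem_ocSet_iff.1 hf).2.2.2 p (a i) (hxf hxp) hi).imp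
            (fun hle => lt_of_le_of_ne hle hp.1) (fun hle => lt_of_le_of_ne hle (Ne.symm hp.1))
        refine ⟨MultiCone.cyl _ i ((e i).symm ⟨x, hxL⟩, t), Subtype.ext ?_⟩
        rw [coneMap_cyl, Homeomorph.apply_symm_apply,
          ← eq_ocVertex (h.mem i) (ocSet_mono Set.inter_subset_left hy)]
        exact hfx.symm
    · push Not at hfa
      refine ⟨MultiCone.base _ ⟨f, mem_ocSet_of_eq_zero hf fun p hp hpR => ?_⟩, rfl⟩
      rw [h.eq_diff, Set.mem_sdiff, not_and_not_right] at hpR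
      obtain ⟨i, rfl⟩ := hpR hp
      exact hfa i

/-- Adding an antichain attaches cones over the links. -/
noncomputable def coneHomeomorph : MultiCone (fun i => h.attach e i) ≃ₜ ΔSp S :=
  have := Finite.of_injective a h.injective
  have (i : ι) : CompactSpace (J i) := (e i).symm.compactSpace
  (h.coneMap e).continuous.homeoOfEquivCompactToT2
    (f := Equiv.ofBijective (h.coneMap e) (h.coneMap_bijective e))

end AntichainExtension

end OrderComplexCone

section ConeHomotopy

open scoped unitInterval
open Topology

/-- The nearest-point retraction of the line onto the unit interval. -/
noncomputable abbrev toI (t : ℝ) : I := Set.projIcc 0 1 zero_le_one t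

lemma continuous_toI : Continuous toI := continuous_projIcc

lemma toI_of_le {t : ℝ} (h : t ≤ 0) : toI t = 0 := Set.projIcc_of_le_left _ h

lemma toI_of_ge {t : ℝ} (h : 1 ≤ t) : toI t = 1 := Set.projIcc_of_right_le _ h

lemma toI_coe (t : I) : toI t = t := Set.projIcc_val _ t

lemma coe_toI {t : ℝ} (h0 : 0 ≤ t) (h1 : t ≤ 1) : (toI t : ℝ) = t := by
  rw [toI, Set.projIcc_of_mem zero_le_one ⟨h0, h1⟩]

namespace MultiCone

variable {ι A : Type} [TopologicalSpace A] {J : ι → Type} [∀ i, TopologicalSpace (J i)]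

section

variable {f g : ∀ i, J i → A} (H : ∀ i, C(J i × I, A)) (h0 : ∀ i j, H i (j, 0) = f i j)
  (h1 : ∀ i j, H i (j, 1) = g i j)

/-- The map between multiple cones induced by a homotopy between the attaching maps. -/
noncomputable def ofHomotopy : C(MultiCone f, MultiCone g) :=
  lift (base g)
    (fun i =>
      { toFun q := if (q.2 : ℝ) ≤ 1 / 2 then base g (H i (q.1, toI (2 * q.2)))
          else cyl g i (q.1, toI (2 * q.2 - 1))
        continuous_toFun := by
          have := continuous_toI
          refine Continuous.if_le (by fun_prop) (by fun_prop) (by fun_prop) continuous_const ?_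
          intro q hq
          rw [hq, toI_of_ge (by norm_num), toI_of_le (by norm_num), h1, cyl_zero] })
    (fun i => apex g i)
    (fun i j => by simp [h0])
    (fun i j => by
      have : ¬ (1 : ℝ) ≤ 1 / 2 := by norm_num
      simp only [ContinuousMap.coe_mk, Set.Icc.coe_one, this, if_false]
      rw [toI_of_ge (by norm_num), cyl_one])

lemma ofHomotopy_base (a : A) : ofHomotopy H h0 h1 (base f a) = base g a := rfl

lemma ofHomotopy_cyl (i : ι) (j : J i) (t : I) : ofHomotopy H h0 h1 (cyl f i (j, t)) =
    if (t : ℝ) ≤ 1 / 2 then base g (H i (j, toI (2 * t))) else cyl g i (j, toI (2 * t - 1)) :=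
  rfl

/-- Following a homotopy back and forth and then the cone is homotopic to the identity. -/
lemma ofHomotopy_comp_homotopic (H' : ∀ i, C(J i × I, A)) (hH : ∀ i j t, H' i (j, t) =
    H i (j, unitInterval.symm t)) (h0' : ∀ i j, H' i (j, 0) = g i j)
    (h1' : ∀ i j, H' i (j, 1) = f i j) :
    ((ofHomotopy H' h0' h1').comp (ofHomotopy H h0 h1)).Homotopic
      (ContinuousMap.id (MultiCone f)) := by
  have hI := continuous_toI
  refine ContinuousMap.Homotopic.trans (g := lift (base f)
    (fun i => (cyl f i).comp ⟨fun q => (q.1, toI (4 * q.2 - 3)), by fun_prop⟩) (apex f) ?_ ?_)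
    ?_ ?_
  · intro i j
    simp [toI_of_le, cyl_zero]
  · intro i j
    simp only [ContinuousMap.comp_apply, ContinuousMap.coe_mk, Set.Icc.coe_one]
    rw [toI_of_ge (by norm_num), cyl_one]
  · obtain ⟨F, Fb, Fc, Fa⟩ := exists_lift_prod (f := f) (Z := I) (Y := MultiCone f)
      ⟨fun q => base f q.1, by fun_prop⟩
      (fun i =>
        { toFun q := if (q.1.2 : ℝ) ≤ 3 / 4 then
            base f (H i (q.1.1, toI (min (min (2 * q.1.2) (3 - 4 * q.1.2)) (1 - q.2))))
            else cyl f i (q.1.1, toI (4 * q.1.2 - 3))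
          continuous_toFun := by
            refine Continuous.if_le (by fun_prop) (by fun_prop) (by fun_prop)
              continuous_const ?_
            intro q hq
            rw [hq, toI_of_le (by norm_num), toI_of_le (by norm_num), h0, cyl_zero] })
      (fun i => .const _ (apex f i))
      (by
        intro i j z
        simp only [ContinuousMap.coe_mk, Set.Icc.coe_zero]
        rw [if_pos (by norm_num), toI_of_le (by simp), h0])
      (by
        intro i j z
        simp only [ContinuousMap.coe_mk, Set.Icc.coe_one]
        rw [if_neg (by norm_num), toI_of_ge (by norm_num), cyl_one]
        rfl)
    refine ⟨⟨F.comp .prodSwap, fun z => ?_, fun z => ?_⟩⟩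
    · induction z using ind with
      | hb a => exact Fb a 0
      | hc i j t =>
        refine (Fc i (j, t) 0).trans ?_
        simp only [ContinuousMap.coe_mk, ContinuousMap.comp_apply, ofHomotopy_cyl H]
        have ht0 := t.2.1
        have ht1 := t.2.2
        by_cases ht : (t : ℝ) ≤ 1 / 2
        · rw [if_pos ht, if_pos (by linarith), ofHomotopy_base]
          congr 4
          rw [min_eq_left (b := 3 - 4 * (t : ℝ)) (by linarith)]
          exact min_eq_left (by simp; linarith)
        · rw [if_neg ht, ofHomotopy_cyl, coe_toI (by linarith) (by linarith)]
          by_cases ht' : (t : ℝ) ≤ 3 / 4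
          · rw [if_pos ht', if_pos (by linarith), hH]
            congr 3
            apply Subtype.ext
            rw [min_eq_right (a := 2 * (t : ℝ)) (by linarith), min_eq_left (by simp; linarith),
              unitInterval.coe_symm_eq, coe_toI (by linarith) (by linarith),
              coe_toI (by linarith) (by linarith)]
            ring
          · rw [if_neg ht', if_neg (by linarith)]
            congr 3
            ring
      | ha i => exact Fa i 0
    · induction z using ind with
      | hb a => exact Fb a 1
      | hc i j t =>
        refine (Fc i (j, t) 1).trans ?_
        simp only [ContinuousMap.coe_mk, lift_cyl, ContinuousMap.comp_apply]
        by_cases ht : (t : ℝ) ≤ 3 / 4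
        · rw [if_pos ht, toI_of_le (t := 4 * (t : ℝ) - 3) (by linarith), toI_of_le (by simp), h0,
            cyl_zero]
        · rw [if_neg ht]
      | ha i => exact Fa i 1
  · obtain ⟨F, Fb, Fc, Fa⟩ := exists_lift_prod (f := f) (Z := I) (Y := MultiCone f)
      ⟨fun q => base f q.1, by fun_prop⟩
      (fun i => (cyl f i).comp ⟨fun q => (q.1.1,
        toI ((1 - q.2) * max 0 (4 * (q.1.2 : ℝ) - 3) + q.2 * q.1.2)), by fun_prop⟩)
      (fun i => .const _ (apex f i))
      (by
        intro i j z
        simp only [ContinuousMap.comp_apply, ContinuousMap.coe_mk, Set.Icc.coe_zero]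
        rw [toI_of_le (by norm_num), cyl_zero])
      (by
        intro i j z
        simp only [ContinuousMap.comp_apply, ContinuousMap.coe_mk, Set.Icc.coe_one]
        rw [toI_of_ge (by norm_num), cyl_one]
        rfl)
    refine ⟨⟨F.comp .prodSwap, fun z => ?_, fun z => ?_⟩⟩
    · induction z using ind with
      | hb a => exact Fb a 0
      | hc i j t =>
        refine (Fc i (j, t) 0).trans ?_
        simp only [ContinuousMap.coe_mk, lift_cyl, ContinuousMap.comp_apply]
        congr 2
        rcases le_total (4 * (t : ℝ) - 3) 0 with h | h
        · rw [toI_of_le h, toI_of_le (by simp [h])]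
        · simp [max_eq_right h]
      | ha i => exact Fa i 0
    · induction z using ind with
      | hb a => exact Fb a 1
      | hc i j t =>
        refine (Fc i (j, t) 1).trans ?_
        simp
      | ha i => exact Fa i 1

end

/-- Homotopic attaching maps yield homotopy equivalent spaces. -/
lemma nonempty_homotopyEquiv {f g : ∀ i, J i → A} (H : ∀ i, C(J i × I, A))
    (h0 : ∀ i j, H i (j, 0) = f i j) (h1 : ∀ i j, H i (j, 1) = g i j) :
    Nonempty (ContinuousMap.HomotopyEquiv (MultiCone f) (MultiCone g)) := by
  let H' (i : ι) : C(J i × I, A) :=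
    (H i).comp ⟨fun q => (q.1, unitInterval.symm q.2), by fun_prop⟩
  have h0' : ∀ i j, H' i (j, 0) = g i j := fun i j => by simp [H', h1]
  have h1' : ∀ i j, H' i (j, 1) = f i j := fun i j => by simp [H', h0]
  exact ⟨ofHomotopy H h0 h1, ofHomotopy H' h0' h1',
    ofHomotopy_comp_homotopic H h0 h1 H' (fun _ _ _ => rfl) h0' h1',
    ofHomotopy_comp_homotopic H' h0' h1' H (fun i j t => by simp [H']) h0 h1⟩

end MultiCone

end ConeHomotopy

section WedgeOfSuspensions

open scoped unitInterval
open Topology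

section Susp

variable {X : Type} [TopologicalSpace X]

/-- The two poles of the suspension. -/
def suspPole (b : Bool) : Susp X := Quot.mk _ (.inl (.inl b))

/-- The segment from a pole of the suspension to the equator. -/
def suspSeg : C(Bool × I × X, Susp X) where
  toFun q := Quot.mk _ (.inl (.inr q))
  continuous_toFun := continuous_quot_mk.comp (continuous_inl.comp continuous_inr)

lemma suspSeg_zero (b : Bool) (x : X) : suspSeg (b, 0, x) = suspPole b :=
  Quot.sound (.inl ⟨b, x, rfl, rfl⟩)

lemma suspSeg_one (b : Bool) (x : X) : suspSeg (b, 1, x) = Quot.mk _ (.inr x) :=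
  Quot.sound (.inr ⟨b, x, rfl, rfl⟩)

/-- The projection from the cylinder to the suspension. -/
noncomputable def suspCyl : C(X × I, Susp X) where
  toFun q := if (q.2 : ℝ) ≤ 1 / 2 then suspSeg (false, toI (2 * q.2), q.1)
    else suspSeg (true, toI (2 - 2 * q.2), q.1)
  continuous_toFun := by
    have := continuous_toI
    refine Continuous.if_le (by fun_prop) (by fun_prop) (by fun_prop) continuous_const ?_
    intro q hq
    rw [hq, toI_of_ge (by norm_num), toI_of_ge (by norm_num), suspSeg_one, suspSeg_one]

lemma suspCyl_apply (x : X) (t : I) :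
    suspCyl (x, t) = if (t : ℝ) ≤ 1 / 2 then suspSeg (false, toI (2 * t), x)
      else suspSeg (true, toI (2 - 2 * t), x) := rfl

lemma suspCyl_zero (x : X) : suspCyl (x, 0) = suspPole false := by
  rw [suspCyl_apply, Set.Icc.coe_zero, if_pos (by norm_num), toI_of_le (by norm_num), suspSeg_zero]

lemma suspCyl_one (x : X) : suspCyl (x, 1) = suspPole true := by
  rw [suspCyl_apply, Set.Icc.coe_one, if_neg (by norm_num), toI_of_le (by norm_num), suspSeg_zero]

/-- The height of a point of the suspension, as a function of the pole and of the distance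
to it. -/
noncomputable def suspHeight (q : Bool × I) : I :=
  toI (q.2 / 2 + (if q.1 then 1 else 0) * (1 - q.2))

lemma continuous_suspHeight : Continuous suspHeight := by
  have h : Continuous fun b : Bool => (if b then (1 : ℝ) else 0) := continuous_of_discreteTopology
  refine continuous_toI.comp ?_
  exact (continuous_subtype_val.comp continuous_snd).div_const 2 |>.add
    ((h.comp continuous_fst).mul
      (continuous_const.sub (continuous_subtype_val.comp continuous_snd)))

lemma suspHeight_zero (b : Bool) : suspHeight (b, 0) = if b then 1 else 0 := by
  cases b
  · simp [suspHeight]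
  · simp [suspHeight]

lemma suspHeight_one (b : Bool) : suspHeight (b, 1) = toI (1 / 2) := by
  simp [suspHeight]

lemma coe_suspHeight_false (t : I) : (suspHeight (false, t) : ℝ) = t / 2 := by
  have h0 := t.2.1
  have h1 := t.2.2
  simp only [suspHeight, Bool.false_eq_true, if_false, zero_mul, add_zero]
  exact coe_toI (by linarith) (by linarith)

lemma coe_suspHeight_true (t : I) : (suspHeight (true, t) : ℝ) = 1 - t / 2 := by
  have h0 := t.2.1
  have h1 := t.2.2
  simp only [suspHeight, if_true, one_mul]
  rw [coe_toI (by linarith) (by linarith)]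
  ring

lemma suspCyl_suspHeight (b : Bool) (t : I) (x : X) :
    suspCyl (x, suspHeight (b, t)) = suspSeg (b, t, x) := by
  have h0 := t.2.1
  have h1 := t.2.2
  rw [suspCyl_apply]
  cases b
  · rw [coe_suspHeight_false, if_pos (by linarith), mul_div_cancel₀ _ two_ne_zero, toI_coe]
  · rw [coe_suspHeight_true]
    have h : 2 - 2 * (1 - (t : ℝ) / 2) = t := by ring
    rw [h, toI_coe]
    split_ifs with ht
    · obtain rfl : t = 1 := Subtype.ext (le_antisymm h1 (by simp; linarith))
      have : toI (2 * (1 - ((1 : I) : ℝ) / 2)) = 1 := toI_of_ge (by norm_num)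
      rw [this, suspSeg_one, suspSeg_one]
    · rfl

/-- A map out of the suspension given by a map from the cylinder and the images of the poles. -/
noncomputable def suspLift {Y : Type} [TopologicalSpace Y] (c : C(X × I, Y)) (y : Bool → Y)
    (h0 : ∀ x, c (x, 0) = y false) (h1 : ∀ x, c (x, 1) = y true) : C(Susp X, Y) where
  toFun := Quot.lift (Sum.elim (Sum.elim y fun q => c (q.2.2, suspHeight (q.1, q.2.1)))
      fun x => c (x, toI (1 / 2))) <| by
    rintro _ _ (⟨b, x, rfl, rfl⟩ | ⟨b, x, rfl, rfl⟩)
    · cases b <;> simp [suspHeight_zero, h0, h1]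
    · simp [suspHeight_one]
  continuous_toFun := by
    have := continuous_suspHeight
    exact continuous_quot_lift _ (.sumElim (.sumElim continuous_of_discreteTopology (by fun_prop))
      (by fun_prop))

section suspLift

variable {Y : Type} [TopologicalSpace Y] (c : C(X × I, Y)) (y : Bool → Y)
    (h0 : ∀ x, c (x, 0) = y false) (h1 : ∀ x, c (x, 1) = y true)

lemma suspLift_suspSeg (b : Bool) (t : I) (x : X) :
    suspLift c y h0 h1 (suspSeg (b, t, x)) = c (x, suspHeight (b, t)) := rfl

lemma suspLift_suspCyl (x : X) (t : I) : suspLift c y h0 h1 (suspCyl (x, t)) = c (x, t) := by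
  have ht0 := t.2.1
  have ht1 := t.2.2
  rw [suspCyl_apply]
  split_ifs with h
  · rw [suspLift_suspSeg]
    congr 2
    apply Subtype.ext
    rw [coe_suspHeight_false, coe_toI (by linarith) (by linarith)]
    ring
  · rw [suspLift_suspSeg]
    congr 2
    apply Subtype.ext
    rw [coe_suspHeight_true, coe_toI (by linarith) (by linarith)]
    ring

end suspLift

lemma susp_ind {p : Susp X → Prop} (hp : ∀ b, p (suspPole b)) (hs : ∀ x t, p (suspCyl (x, t)))
    (z : Susp X) : p z := by
  rcases z with ⟨(b | ⟨b, t, x⟩) | x⟩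
  · exact hp b
  · have h := hs x (suspHeight (b, t))
    rwa [suspCyl_suspHeight] at h
  · have h := hs x (suspHeight (false, 1))
    rwa [suspCyl_suspHeight, suspSeg_one] at h

end Susp

variable {ι A : Type} [TopologicalSpace A] (J : ι → Type) [∀ i, TopologicalSpace (J i)] (x₀ : A)

/-- The wedge of `A` and the suspensions of the spaces `J i`. -/
abbrev SuspWedge : Type :=
  Wedge A (BigWedge (fun i => Susp (J i)) fun _ => suspPole false) x₀ BigWedge.base

namespace SuspWedge

/-- The inclusion of the first summand. -/
def inl : C(A, SuspWedge J x₀) where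
  toFun a := Quot.mk _ (.inl a)
  continuous_toFun := continuous_quot_mk.comp continuous_inl

/-- The inclusion of a suspension. -/
def inr (i : ι) : C(Susp (J i), SuspWedge J x₀) where
  toFun z := Quot.mk _ (.inr (Quot.mk _ (.inl ⟨i, z⟩)))
  continuous_toFun := by
    have h := (continuous_quot_mk (r := fun a b : (Σ i, Susp (J i)) ⊕ Unit =>
      (∃ i, a = .inl ⟨i, suspPole false⟩) ∧ b = .inr ())).comp <| continuous_inl.comp <|
        @continuous_sigmaMk ι (fun i => Susp (J i)) _ i
    exact continuous_quot_mk.comp (continuous_inr.comp h)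

lemma inr_suspPole_false (i : ι) : inr J x₀ i (suspPole false) = inl J x₀ x₀ := by
  refine Eq.symm ((Quot.sound ⟨rfl, rfl⟩).trans ?_)
  exact congrArg (fun z => Quot.mk _ (Sum.inr z)) (Quot.sound ⟨⟨i, rfl⟩, rfl⟩).symm

/-- The map from the space with cones attached along constant maps to the wedge. -/
noncomputable def ofMultiCone : C(MultiCone fun i (_ : J i) => x₀, SuspWedge J x₀) :=
  MultiCone.lift (inl J x₀) (fun i => (inr J x₀ i).comp suspCyl)
    (fun i => inr J x₀ i (suspPole true))
    (fun i j => by rw [ContinuousMap.comp_apply, suspCyl_zero, inr_suspPole_false])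
    (fun i j => by rw [ContinuousMap.comp_apply, suspCyl_one])

/-- The map from a suspension to a cone attached along a constant map. -/
noncomputable def coneOfSusp (i : ι) : C(Susp (J i), MultiCone fun i (_ : J i) => x₀) :=
  suspLift (MultiCone.cyl (fun i (_ : J i) => x₀) i)
    (fun b => if b then MultiCone.apex _ i else MultiCone.base _ x₀)
    (fun _ => MultiCone.cyl_zero _ _ _) (fun _ => MultiCone.cyl_one _ _ _)

lemma coneOfSusp_suspCyl (i : ι) (x : J i) (t : I) :
    coneOfSusp J x₀ i (suspCyl (x, t)) = MultiCone.cyl _ i (x, t) :=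
  suspLift_suspCyl _ _ _ _ _ _

lemma ofMultiCone_coneOfSusp (i : ι) (z : Susp (J i)) :
    ofMultiCone J x₀ (coneOfSusp J x₀ i z) = inr J x₀ i z := by
  induction z using susp_ind with
  | hp b =>
    cases b
    · exact (inr_suspPole_false J x₀ i).symm
    · rfl
  | hs x t =>
    rw [coneOfSusp_suspCyl]
    rfl

/-- The map from the wedge to the space with cones attached along constant maps. -/
noncomputable def toMultiCone : C(SuspWedge J x₀, MultiCone fun i (_ : J i) => x₀) where
  toFun := Quot.lift (Sum.elim (MultiCone.base _) (Quot.lift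
      (Sum.elim (fun s => coneOfSusp J x₀ s.1 s.2) fun _ => MultiCone.base _ x₀) (by
        rintro _ _ ⟨⟨i, rfl⟩, rfl⟩
        rfl))) (by
      rintro _ _ ⟨rfl, rfl⟩
      rfl)
  continuous_toFun := by
    refine continuous_quot_lift _ (.sumElim (ContinuousMap.continuous _)
      (continuous_quot_lift _ (.sumElim (continuous_sigma fun i => ?_) continuous_const)))
    exact (coneOfSusp J x₀ i).continuous

/-- Attaching cones along constant maps yields a wedge of suspensions. -/
noncomputable def multiConeHomeomorph : MultiCone (fun i (_ : J i) => x₀) ≃ₜ SuspWedge J x₀ where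
  toFun := ofMultiCone J x₀
  invFun := toMultiCone J x₀
  left_inv z := by
    induction z using MultiCone.ind with
    | hb a => rfl
    | hc i j t => exact coneOfSusp_suspCyl J x₀ i j t
    | ha i => rfl
  right_inv z := by
    rcases z with ⟨a | ⟨⟨i, z⟩ | ⟨⟩⟩⟩
    · rfl
    · exact ofMultiCone_coneOfSusp J x₀ i z
    · exact Quot.sound ⟨rfl, rfl⟩

end SuspWedge

end WedgeOfSuspensions

section CubeExtension

open scoped unitInterval
open Topology

/-- Every map from `C` to `A` extends to a map from `B` to `A`. -/
def HasExtension {B : Type} [TopologicalSpace B] (C : Set B) (A : Type) [TopologicalSpace A] :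
    Prop :=
  ∀ g : B → A, ContinuousOn g C → ∃ h : C(B, A), Set.EqOn h g C

/-- The affine identification of the cube with the unit ball of the sup norm. -/
def cubeVec {n : ℕ} (y : Fin n → I) : Fin n → ℝ := fun i => 2 * y i - 1

/-- The inverse of the affine identification of the cube with the unit ball. -/
noncomputable def vecCube {n : ℕ} (w : Fin n → ℝ) : Fin n → I := fun i => toI ((1 + w i) / 2)

lemma continuous_cubeVec {n : ℕ} : Continuous (cubeVec (n := n)) := by
  unfold cubeVec
  fun_prop

lemma continuous_vecCube {n : ℕ} : Continuous (vecCube (n := n)) := by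
  have := continuous_toI
  unfold vecCube
  fun_prop

lemma vecCube_cubeVec {n : ℕ} (y : Fin n → I) : vecCube (cubeVec y) = y := by
  ext i
  simp [vecCube, cubeVec]

lemma cubeVec_vecCube {n : ℕ} {w : Fin n → ℝ} (hw : ‖w‖ ≤ 1) : cubeVec (vecCube w) = w := by
  ext i
  have h := abs_le.1 ((norm_le_pi_norm w i).trans hw)
  simp only [cubeVec, vecCube]
  rw [coe_toI (by linarith) (by linarith)]
  ring

lemma norm_cubeVec_le {n : ℕ} (y : Fin n → I) : ‖cubeVec y‖ ≤ 1 := by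
  refine (pi_norm_le_iff_of_nonneg zero_le_one).2 fun i => abs_le.2 ⟨?_, ?_⟩
  · have := (y i).2.1
    simp only [cubeVec]
    linarith
  · have := (y i).2.2
    simp only [cubeVec]
    linarith

lemma mem_boundary_iff {n : ℕ} (y : Fin n → I) : y ∈ Cube.boundary (Fin n) ↔ ‖cubeVec y‖ = 1 := by
  constructor
  · rintro ⟨i, hi⟩
    refine le_antisymm (norm_cubeVec_le y) ?_
    refine le_trans (le_of_eq ?_) (norm_le_pi_norm (cubeVec y) i)
    rcases hi with hi | hi <;> simp [cubeVec, hi]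
    norm_num
  · intro h
    by_contra hy
    refine ne_of_lt ((pi_norm_lt_iff one_pos).2 fun i => ?_) h
    have h0 : y i ≠ 0 := fun h => hy ⟨i, .inl h⟩
    have h1 : y i ≠ 1 := fun h => hy ⟨i, .inr h⟩
    have h0 := unitInterval.pos_iff_ne_zero.2 h0
    have h1 := unitInterval.lt_one_iff_ne_one.2 h1
    have h0 : (0 : ℝ) < y i := h0
    have h1 : (y i : ℝ) < 1 := h1
    rw [Real.norm_eq_abs, abs_lt]
    constructor <;> simp only [cubeVec] <;> linarith

/-- A map from the unit ball to the space of one dimension more whose direction sweeps out the unit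
sphere, collapsing the boundary of the ball to a point. -/
noncomputable def sweep {n : ℕ} (v : Fin n → ℝ) : Fin (n + 1) → ℝ :=
  Fin.cons (1 - 2 * ‖v‖) ((1 - ‖v‖) • v)

lemma continuous_sweep {n : ℕ} : Continuous (sweep (n := n)) := by
  refine continuous_pi fun i => ?_
  refine Fin.cases ?_ (fun i => ?_) i
  · simp only [sweep, Fin.cons_zero]
    fun_prop
  · simp only [sweep, Fin.cons_succ]
    fun_prop

lemma sweep_ne_zero {n : ℕ} (v : Fin n → ℝ) : sweep v ≠ 0 := by
  intro h
  have h0 : 1 - 2 * ‖v‖ = 0 := congrFun h 0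
  have h1 : (1 - ‖v‖) • v = 0 := congrArg Fin.tail h
  rcases smul_eq_zero.1 h1 with h1 | h1
  · linarith
  · simp [h1] at h0

lemma sweep_injective {n : ℕ} {v v' : Fin n → ℝ} (hv : ‖v‖ ≤ 1) (hv' : ‖v'‖ ≤ 1) {c : ℝ}
    (hc : 0 < c) (h : sweep v = c • sweep v') : v = v' ∨ ‖v‖ = 1 ∧ ‖v'‖ = 1 := by
  have h0 : 1 - 2 * ‖v‖ = c * (1 - 2 * ‖v'‖) := congrFun h 0
  have h1 : (1 - ‖v‖) • v = c • (1 - ‖v'‖) • v' := congrArg Fin.tail h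
  have h2 := congrArg norm h1
  rw [norm_smul, norm_smul, norm_smul, Real.norm_of_nonneg (sub_nonneg.2 hv),
    Real.norm_of_nonneg (sub_nonneg.2 hv'), Real.norm_of_nonneg hc.le] at h2
  have hr := norm_nonneg v
  have hr' := norm_nonneg v'
  have key : (‖v'‖ - ‖v‖) * ((1 - ‖v‖) * (1 - ‖v'‖) + ‖v‖ * ‖v'‖) = 0 := by
    refine (mul_eq_zero_iff_left hc.ne').1 ?_
    linear_combination c * (1 - ‖v'‖) * ‖v'‖ * h0 - c * (1 - 2 * ‖v'‖) * h2
  have hpos := mul_nonneg (sub_nonneg.2 hv) (sub_nonneg.2 hv')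
  have hpos' := mul_nonneg hr hr'
  rcases mul_eq_zero.1 key with key | key
  · have hrr : ‖v‖ = ‖v'‖ := by linarith
    rw [← hrr] at h0 h1 h2
    rcases eq_or_ne ‖v‖ 1 with h | hr1
    · exact .inr ⟨h, hrr ▸ h⟩
    rcases eq_or_ne ‖v‖ 0 with h | hr0
    · rw [norm_eq_zero.1 h, norm_eq_zero.1 (hrr ▸ h : ‖v'‖ = 0)]
      exact .inl rfl
    have hne := mul_ne_zero (sub_ne_zero.2 hr1.symm) hr0
    have hc1 : c = 1 := by
      refine mul_right_cancel₀ hne ?_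
      linarith
    rw [hc1, one_smul] at h1
    exact .inl (smul_right_injective _ (sub_ne_zero.2 hr1.symm) h1)
  · have e1 : (1 - ‖v‖) * (1 - ‖v'‖) = 0 := by linarith
    have e2 : ‖v‖ * ‖v'‖ = 0 := by linarith
    rcases mul_eq_zero.1 e2 with e2 | e2 <;> rw [e2] at e1 h0 <;> nlinarith

lemma exists_sweep_eq {n : ℕ} (hn : n ≠ 0) {w : Fin (n + 1) → ℝ} (hw : ‖w‖ = 1) :
    ∃ v : Fin n → ℝ, ‖v‖ ≤ 1 ∧ ∃ c : ℝ, 0 < c ∧ sweep v = c • w := by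
  have hw' : w = Fin.cons (w 0) (Fin.tail w) := (Fin.cons_self_tail w).symm
  by_cases hb : Fin.tail w = 0
  · have h01 : |w 0| = 1 := by
      refine le_antisymm (hw ▸ norm_le_pi_norm w 0) ?_
      rw [← hw]
      refine (pi_norm_le_iff_of_nonneg (abs_nonneg _)).2 fun i => ?_
      refine Fin.cases le_rfl (fun i => ?_) i
      have : w i.succ = 0 := congrFun hb i
      simp [this]
    rcases (abs_eq zero_le_one).1 h01 with h0 | h0
    · refine ⟨0, by simp, 1, one_pos, ?_⟩
      rw [one_smul, hw', hb, h0]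
      simp [sweep]
    · have : Nonempty (Fin n) := ⟨⟨0, Nat.pos_of_ne_zero hn⟩⟩
      have h1 : ‖(fun _ => 1 : Fin n → ℝ)‖ = 1 := by simp
      refine ⟨fun _ => 1, h1.le, 1, one_pos, ?_⟩
      rw [one_smul, hw', hb, h0, sweep, h1]
      norm_num
  · have hβ : 0 < ‖Fin.tail w‖ := norm_pos_iff.2 hb
    obtain ⟨r, hr, hr0⟩ : (0 : ℝ) ∈
        (fun r : ℝ => w 0 * (1 - r) * r - (1 - 2 * r) * ‖Fin.tail w‖) '' Set.Icc 0 1 := by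
      refine intermediate_value_Icc zero_le_one (by fun_prop) ⟨?_, ?_⟩
      · simp
      · norm_num
    have hr0 : (1 - 2 * r) * ‖Fin.tail w‖ = w 0 * (1 - r) * r := by
      simp only at hr0
      linarith
    have hr1 : r ≠ 0 := by
      rintro rfl
      norm_num at hr0
      exact hb hr0
    have hr2 : r ≠ 1 := by
      rintro rfl
      norm_num at hr0
      exact hb hr0
    have hnorm : ‖(r / ‖Fin.tail w‖) • Fin.tail w‖ = r := by
      rw [norm_smul, Real.norm_of_nonneg (div_nonneg hr.1 hβ.le), div_mul_cancel₀ _ hβ.ne']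
    refine ⟨(r / ‖Fin.tail w‖) • Fin.tail w, hnorm.trans_le hr.2,
      (1 - r) * r / ‖Fin.tail w‖, ?_, ?_⟩
    · have := lt_of_le_of_ne hr.1 hr1.symm
      have := sub_pos.2 (lt_of_le_of_ne hr.2 hr2)
      positivity
    · ext i
      rw [sweep, hnorm]
      refine Fin.cases ?_ (fun i => ?_) i
      · simp only [Fin.cons_zero, Pi.smul_apply, smul_eq_mul]
        field_simp
        linarith
      · simp only [Fin.cons_succ, Pi.smul_apply, smul_eq_mul, Fin.tail]
        ring

/-- The point of the unit sphere in the direction of `sweep`. -/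
noncomputable def sphereSweep {n : ℕ} (v : Fin n → ℝ) : Fin (n + 1) → ℝ := ‖sweep v‖⁻¹ • sweep v

lemma continuous_sphereSweep {n : ℕ} : Continuous (sphereSweep (n := n)) :=
  (continuous_sweep.norm.inv₀ fun v => norm_ne_zero_iff.2 (sweep_ne_zero v)).smul continuous_sweep

lemma norm_sphereSweep {n : ℕ} (v : Fin n → ℝ) : ‖sphereSweep v‖ = 1 := by
  rw [sphereSweep, norm_smul, norm_inv, norm_norm,
    inv_mul_cancel₀ (norm_ne_zero_iff.2 (sweep_ne_zero v))]

lemma sphereSweep_of_norm_eq_one {n : ℕ} {v : Fin n → ℝ} (hv : ‖v‖ = 1) :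
    sphereSweep v = Fin.cons (-1) 0 := by
  have h : sweep v = Fin.cons (-1) 0 := by
    rw [sweep, hv]
    norm_num
  have h1 : ‖(Fin.cons (-1) 0 : Fin (n + 1) → ℝ)‖ = 1 := by
    refine le_antisymm ((pi_norm_le_iff_of_nonneg zero_le_one).2 fun i => ?_) ?_
    · refine Fin.cases ?_ (fun i => ?_) i <;> simp
    · simpa using norm_le_pi_norm (Fin.cons (-1) 0 : Fin (n + 1) → ℝ) 0
  rw [sphereSweep, h, h1, inv_one, one_smul]

lemma sphereSweep_injective {n : ℕ} {v v' : Fin n → ℝ} (hv : ‖v‖ ≤ 1) (hv' : ‖v'‖ ≤ 1)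
    (h : sphereSweep v = sphereSweep v') : v = v' ∨ ‖v‖ = 1 ∧ ‖v'‖ = 1 := by
  have h1 := norm_pos_iff.2 (sweep_ne_zero v)
  have h2 := norm_pos_iff.2 (sweep_ne_zero v')
  refine sweep_injective hv hv' (c := ‖sweep v‖ * ‖sweep v'‖⁻¹) (by positivity) ?_
  rw [mul_smul]
  refine Eq.trans ?_ (congrArg (‖sweep v‖ • ·) h)
  simp only [sphereSweep]
  rw [smul_inv_smul₀ h1.ne']

lemma exists_sphereSweep_eq {n : ℕ} (hn : n ≠ 0) {w : Fin (n + 1) → ℝ} (hw : ‖w‖ = 1) :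
    ∃ v : Fin n → ℝ, ‖v‖ ≤ 1 ∧ sphereSweep v = w := by
  obtain ⟨v, hv, c, hc, h⟩ := exists_sweep_eq hn hw
  refine ⟨v, hv, ?_⟩
  rw [sphereSweep, h, norm_smul, hw, mul_one, Real.norm_of_nonneg hc.le, inv_smul_smul₀ (ne_of_gt hc)]

/-- The presentation of a cube as a cone over the quotient of a cube by its boundary. -/
noncomputable def cubeCone {n : ℕ} (q : I × (Fin n → I)) : Fin (n + 1) → I :=
  vecCube ((1 - (q.1 : ℝ)) • sphereSweep (cubeVec q.2))

lemma continuous_cubeCone {n : ℕ} : Continuous (cubeCone (n := n)) := by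
  have := continuous_sphereSweep (n := n)
  have := continuous_cubeVec (n := n)
  exact continuous_vecCube.comp (by fun_prop)

lemma cubeVec_cubeCone {n : ℕ} (t : I) (y : Fin n → I) :
    cubeVec (cubeCone (t, y)) = (1 - (t : ℝ)) • sphereSweep (cubeVec y) := by
  refine cubeVec_vecCube ?_
  rw [norm_smul, norm_sphereSweep, mul_one, Real.norm_of_nonneg (sub_nonneg.2 t.2.2)]
  linarith [t.2.1]

lemma norm_cubeVec_cubeCone {n : ℕ} (t : I) (y : Fin n → I) :
    ‖cubeVec (cubeCone (t, y))‖ = 1 - t := by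
  rw [cubeVec_cubeCone, norm_smul, norm_sphereSweep, mul_one,
    Real.norm_of_nonneg (sub_nonneg.2 t.2.2)]

lemma cubeCone_mem_boundary_iff {n : ℕ} (t : I) (y : Fin n → I) :
    cubeCone (t, y) ∈ Cube.boundary (Fin (n + 1)) ↔ t = 0 := by
  rw [mem_boundary_iff, norm_cubeVec_cubeCone, ← Subtype.coe_inj, Set.Icc.coe_zero]
  constructor <;> intro h <;> linarith

lemma cubeCone_of_mem_boundary {n : ℕ} (t : I) {y : Fin n → I} (hy : y ∈ Cube.boundary (Fin n)) :
    cubeCone (t, y) = vecCube ((1 - (t : ℝ)) • Fin.cons (-1) 0) := by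
  rw [cubeCone, sphereSweep_of_norm_eq_one ((mem_boundary_iff y).1 hy)]

lemma cubeCone_surjective {n : ℕ} (hn : n ≠ 0) : Function.Surjective (cubeCone (n := n)) := by
  intro z
  obtain ⟨w, hw, h⟩ : ∃ w : Fin (n + 1) → ℝ, ‖w‖ = 1 ∧ ‖cubeVec z‖ • w = cubeVec z := by
    rcases eq_or_ne (cubeVec z) 0 with h | h
    · exact ⟨fun _ => 1, by simp, by simp [h]⟩
    · refine ⟨‖cubeVec z‖⁻¹ • cubeVec z, ?_, smul_inv_smul₀ (norm_ne_zero_iff.2 h) _⟩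
      rw [norm_smul, norm_inv, norm_norm, inv_mul_cancel₀ (norm_ne_zero_iff.2 h)]
  obtain ⟨v, hv, hvw⟩ := exists_sphereSweep_eq hn hw
  refine ⟨(⟨1 - ‖cubeVec z‖, sub_nonneg.2 (norm_cubeVec_le z), ?_⟩, vecCube v), ?_⟩
  · linarith [norm_nonneg (cubeVec z)]
  · rw [cubeCone, cubeVec_vecCube hv, hvw, sub_sub_cancel, h, vecCube_cubeVec]

lemma cubeCone_eq {n : ℕ} {t t' : I} {y y' : Fin n → I} (h : cubeCone (t, y) = cubeCone (t', y')) :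
    t = t' ∧ (t = 1 ∨ y = y' ∨ y ∈ Cube.boundary (Fin n) ∧ y' ∈ Cube.boundary (Fin n)) := by
  have ht : t = t' := by
    have := congrArg (fun z => ‖cubeVec z‖) h
    simp only [norm_cubeVec_cubeCone] at this
    exact Subtype.ext (by linarith)
  subst ht
  refine ⟨rfl, or_iff_not_imp_left.2 fun h1 => ?_⟩
  have h1 : 1 - (t : ℝ) ≠ 0 := sub_ne_zero.2 fun h => h1 (Subtype.ext h.symm)
  have h := congrArg cubeVec h
  rw [cubeVec_cubeCone, cubeVec_cubeCone] at h
  simp only [mem_boundary_iff]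
  refine (sphereSweep_injective (norm_cubeVec_le _) (norm_cubeVec_le _)
    (smul_right_injective _ h1 h)).imp_left fun h => ?_
  rw [← vecCube_cubeVec y, h, vecCube_cubeVec]

variable {A : Type} [TopologicalSpace A]

lemma hasExtension_boundary_succ {n : ℕ} (hn : n ≠ 0) (h : ∀ x : A, Subsingleton (π_ n A x)) :
    HasExtension (Cube.boundary (Fin (n + 1))) A := by
  intro g hg
  have hb (y : Fin n → I) : cubeCone (0, y) ∈ Cube.boundary (Fin (n + 1)) :=
    (cubeCone_mem_boundary_iff 0 y).2 rfl
  let x : A := g (vecCube (Fin.cons (-1) 0))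
  let p : GenLoop (Fin n) A x :=
    ⟨⟨fun y => g (cubeCone (0, y)),
      hg.comp_continuous (continuous_cubeCone.comp (by fun_prop)) hb⟩, fun y hy => by
      simp [cubeCone_of_mem_boundary 0 hy, x]⟩
  have hp : GenLoop.Homotopic p GenLoop.const := Quotient.exact ((h x).elim ⟦p⟧ ⟦GenLoop.const⟧)
  obtain ⟨F⟩ := hp
  have hq : IsQuotientMap (⟨cubeCone, continuous_cubeCone⟩ : C(I × (Fin n → I), Fin (n + 1) → I)) :=
    IsQuotientMap.of_surjective_continuous (cubeCone_surjective hn) continuous_cubeCone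
  have hF : Function.FactorsThrough F.toContinuousMap
      (⟨cubeCone, continuous_cubeCone⟩ : C(I × (Fin n → I), Fin (n + 1) → I)) := by
    rintro ⟨t, y⟩ ⟨t', y'⟩ hty
    obtain ⟨rfl, rfl | rfl | ⟨hy, hy'⟩⟩ := cubeCone_eq hty
    · exact (F.apply_one y).trans (F.apply_one y').symm
    · rfl
    · exact ((F.eq_fst t hy).trans (p.2 y hy)).trans ((F.eq_fst t hy').trans (p.2 y' hy')).symm
  refine ⟨hq.lift F.toContinuousMap hF, fun z hz => ?_⟩
  obtain ⟨⟨t, y⟩, rfl⟩ := cubeCone_surjective hn z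
  obtain rfl := (cubeCone_mem_boundary_iff t y).1 hz
  refine (DFunLike.congr_fun (hq.lift_comp F.toContinuousMap hF) (0, y)).trans ?_
  exact F.apply_zero y

lemma hasExtension_boundary_zero [Nonempty A] : HasExtension (Cube.boundary (Fin 0)) A :=
  fun _ _ => ⟨.const _ (Classical.arbitrary A), fun _ hy => hy.choose.elim0⟩

lemma hasExtension_boundary_one [PathConnectedSpace A] :
    HasExtension (Cube.boundary (Fin 1)) A := by
  intro g _
  obtain ⟨γ⟩ := PathConnectedSpace.joined (g fun _ => 0) (g fun _ => 1)
  refine ⟨⟨fun y => γ (y 0), by fun_prop⟩, ?_⟩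
  rintro y ⟨i, hi⟩
  obtain rfl := Subsingleton.elim i 0
  rcases hi with hi | hi
  · obtain rfl : y = fun _ => 0 := funext fun j => by rw [Subsingleton.elim j 0, hi]
    exact γ.source
  · obtain rfl : y = fun _ => 1 := funext fun j => by rw [Subsingleton.elim j 0, hi]
    exact γ.target

lemma hasExtension_boundary [PathConnectedSpace A] {k : ℕ}
    (h : ∀ (x : A) (i : ℕ), 1 ≤ i → i ≤ k → Subsingleton (π_ i A x)) :
    ∀ j ≤ k + 1, HasExtension (Cube.boundary (Fin j)) A
  | 0, _ => hasExtension_boundary_zero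
  | 1, _ => hasExtension_boundary_one
  | n + 2, hj => hasExtension_boundary_succ n.succ_ne_zero fun x => h x _ (by lia) (by lia)

end CubeExtension

section ConeExtension

open scoped unitInterval
open Topology

variable {A : Type} [TopologicalSpace A]

lemma isClosed_cubeBoundary (n : ℕ) : IsClosed (Cube.boundary (Fin n)) := by
  have : Cube.boundary (Fin n) = (fun y => ‖cubeVec y‖) ⁻¹' {1} := Set.ext mem_boundary_iff
  rw [this]
  exact isClosed_singleton.preimage continuous_cubeVec.norm

lemma HasExtension.of_homeomorph {B B' : Type} [TopologicalSpace B] [TopologicalSpace B']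
    (e : B ≃ₜ B') {C : Set B'} (h : HasExtension (e ⁻¹' C) A) : HasExtension C A := by
  intro g hg
  obtain ⟨F, hF⟩ := h (g ∘ e) (hg.comp e.continuous.continuousOn fun _ h => h)
  refine ⟨F.comp (e.symm : C(B', B)), fun x hx => ?_⟩
  refine (hF (x := e.symm x) (by simpa using hx)).trans ?_
  simp

lemma cons_mem_cubeBoundary_iff {n : ℕ} (t : I) (z : Fin n → I) :
    (Fin.cons t z : Fin (n + 1) → I) ∈ Cube.boundary (Fin (n + 1)) ↔
      (t = 0 ∨ t = 1) ∨ z ∈ Cube.boundary (Fin n) := by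
  simp [Cube.boundary, Fin.exists_fin_succ]

/-- Extension of maps from the cylinder boundary over a cube, cone by cone. -/
lemma MultiCone.hasExtension {ι X : Type} [TopologicalSpace X] {J : ι → Type}
    [∀ i, TopologicalSpace (J i)] (f : ∀ i, C(J i, X)) {j : ℕ}
    (hX : HasExtension (Set.univ ×ˢ Cube.boundary (Fin j) : Set (X × (Fin j → I))) A)
    (hj : HasExtension (Cube.boundary (Fin j)) A)
    (hJ : ∀ i, HasExtension
      (Set.univ ×ˢ Cube.boundary (Fin (j + 1)) : Set (J i × (Fin (j + 1) → I))) A) :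
    HasExtension
      (Set.univ ×ˢ Cube.boundary (Fin j) : Set (MultiCone (fun i => f i) × (Fin j → I))) A := by
  classical
  intro g hg
  have hmem {Y : Type} (y : Y) {z : Fin j → I} (hz : z ∈ Cube.boundary (Fin j)) :
      (y, z) ∈ (Set.univ ×ˢ Cube.boundary (Fin j) : Set (Y × (Fin j → I))) := ⟨trivial, hz⟩
  obtain ⟨b, hb⟩ := hX (fun q => g (base _ q.1, q.2))
    (hg.comp (Continuous.continuousOn (by fun_prop)) fun q hq => ⟨trivial, hq.2⟩)
  have hy (i : ι) := hj (fun z => g (apex _ i, z))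
    (hg.comp (Continuous.continuousOn (by fun_prop)) fun q hq => ⟨trivial, hq⟩)
  choose y hy using hy
  let G (i : ι) (q : J i × (Fin (j + 1) → I)) : A :=
    if q.2 0 = 0 then b (f i q.1, Fin.tail q.2)
    else if q.2 0 = 1 then y i (Fin.tail q.2) else g (cyl _ i (q.1, q.2 0), Fin.tail q.2)
  have htail : Continuous (Fin.tail : (Fin (j + 1) → I) → Fin j → I) :=
    continuous_pi fun i => continuous_apply _
  have G0 (i : ι) (x : J i) (z) (h : z 0 = 0) : G i (x, z) = b (f i x, Fin.tail z) := if_pos h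
  have G1 (i : ι) (x : J i) (z) (h : z 0 = 1) : G i (x, z) = y i (Fin.tail z) := by
    simp [G, h]
  have Gg (i : ι) (x : J i) (z) (h : (Fin.tail z : Fin j → I) ∈ Cube.boundary (Fin j)) :
      G i (x, z) = g (cyl _ i (x, z 0), Fin.tail z) := by
    by_cases h0 : z 0 = 0
    · rw [G0 i x z h0, h0, cyl_zero]
      exact hb (hmem _ h)
    by_cases h1 : z 0 = 1
    · rw [G1 i x z h1, h1, cyl_one]
      exact hy i h
    simp [G, h0, h1]
  have hG (i : ι) : ContinuousOn (G i) (Set.univ ×ˢ Cube.boundary (Fin (j + 1))) := by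
    have c0 : IsClosed {q : J i × (Fin (j + 1) → I) | q.2 0 = 0} :=
      isClosed_eq (by fun_prop) continuous_const
    have c1 : IsClosed {q : J i × (Fin (j + 1) → I) | q.2 0 = 1} :=
      isClosed_eq (by fun_prop) continuous_const
    have c2 : IsClosed {q : J i × (Fin (j + 1) → I) | Fin.tail q.2 ∈ Cube.boundary (Fin j)} :=
      (isClosed_cubeBoundary j).preimage (htail.comp continuous_snd)
    refine ContinuousOn.mono (ContinuousOn.union_of_isClosed
      (ContinuousOn.union_of_isClosed ?_ ?_ c0 c1) ?_ (c0.union c1) c2) ?_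
    · exact ContinuousOn.congr (Continuous.continuousOn (by fun_prop)) fun q hq => G0 i q.1 q.2 hq
    · exact ContinuousOn.congr (Continuous.continuousOn (by fun_prop)) fun q hq => G1 i q.1 q.2 hq
    · refine ContinuousOn.congr (hg.comp (f := fun q : J i × (Fin (j + 1) → I) =>
        (cyl (fun i => f i) i (q.1, q.2 0), Fin.tail q.2)) (Continuous.continuousOn (by fun_prop))
          fun q hq => ⟨trivial, hq⟩) fun q hq => Gg i q.1 q.2 hq
    · rintro ⟨x, z⟩ ⟨-, hz⟩
      rw [← Fin.cons_self_tail z, cons_mem_cubeBoundary_iff] at hz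
      exact hz
  have hc (i : ι) := hJ i (G i) (hG i)
  choose c hc using hc
  have hcons (i : ι) : Continuous fun q : (J i × I) × (Fin j → I) =>
      (q.1.1, (Fin.cons q.1.2 q.2 : Fin (j + 1) → I)) := by
    refine continuous_fst.fst.prodMk (continuous_pi fun l => ?_)
    refine Fin.cases ?_ (fun l => ?_) l
    · simp only [Fin.cons_zero]
      fun_prop
    · simp only [Fin.cons_succ]
      fun_prop
  have hcG (i : ι) (x : J i) (t : I) (z : Fin j → I)
      (h : (t = 0 ∨ t = 1) ∨ z ∈ Cube.boundary (Fin j)) :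
      c i (x, Fin.cons t z) = G i (x, Fin.cons t z) :=
    hc i ⟨trivial, (cons_mem_cubeBoundary_iff t z).2 h⟩
  obtain ⟨F, Fb, Fc, Fa⟩ := exists_lift_prod (f := fun i => f i) b
    (fun i => (c i).comp ⟨_, hcons i⟩) y
    (fun i x z => (hcG i x 0 z (.inl (.inl rfl))).trans (G0 i x _ rfl))
    (fun i x z => (hcG i x 1 z (.inl (.inr rfl))).trans (G1 i x _ rfl))
  refine ⟨F, ?_⟩
  rintro ⟨w, z⟩ ⟨-, hz⟩
  induction w using MultiCone.ind with
  | hb x => exact (Fb x z).trans (hb (hmem x hz))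
  | hc i x t => exact ((Fc i (x, t) z).trans (hcG i x t z (.inr hz))).trans (Gg i x _ hz)
  | ha i => exact (Fa i z).trans (hy i hz)

variable {P : Type} [PartialOrder P] [Finite P]

/-- Maps into a highly connected space extend over the product of a cube and an order complex of
small dimension, relative to the product with the boundary of the cube. -/
lemma hasExtension_orderComplex {k : ℕ} (hA : ∀ j ≤ k + 1, HasExtension (Cube.boundary (Fin j)) A)
    (S : Set P) (j : ℕ)
    (hS : ∀ c : Finset P, ↑c ⊆ S → IsChain (· ≤ ·) (c : Set P) → c.Nonempty → c.card + j ≤ k + 2) :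
    HasExtension (Set.univ ×ˢ Cube.boundary (Fin j) : Set (ΔSp S × (Fin j → I))) A := by
  classical
  induction S using WellFoundedLT.induction generalizing j with
  | ind S ih =>
  rcases S.eq_empty_or_nonempty with rfl | ⟨v, hv⟩
  · have hempty : IsEmpty (ΔSp (∅ : Set P)) := ⟨fun f => by
      have := f.2.2.2.1
      simp [ocSet_eq_zero f.2 (Set.notMem_empty _)] at this⟩
    exact fun g _ => ⟨⟨g, continuous_of_discreteTopology⟩, fun _ _ => rfl⟩
  have h : AntichainExtension (fun _ : Unit => v) (S \ Set.range fun _ : Unit => v) S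
      (fun _ => S ∩ (Set.Iio v ∪ Set.Ioi v)) :=
    ⟨fun _ => hv, fun _ _ h => (h rfl).elim, rfl, fun _ => rfl⟩
  have hR : (S \ Set.range fun _ : Unit => v) < S :=
    (Set.ssubset_iff_of_subset h.subset).2 ⟨v, hv, h.notMem ()⟩
  have hL : (S ∩ (Set.Iio v ∪ Set.Ioi v)) < S :=
    (Set.ssubset_iff_of_subset (h.link_subset' ())).2 ⟨v, hv, h.notMem_link () ()⟩
  refine HasExtension.of_homeomorph
    ((h.coneHomeomorph fun _ => Homeomorph.refl _).prodCongr (.refl _)) ?_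
  refine MultiCone.hasExtension _ ?_ ?_ fun _ => ?_
  · exact ih _ hR j fun c hc => hS c (hc.trans h.subset)
  · refine hA j ?_
    have := hS {v} (by simpa) (by simp) (by simp)
    rw [Finset.card_singleton] at this
    lia
  · refine ih _ hL (j + 1) fun c hc hc' _ => ?_
    have hvc : v ∉ c := fun hvc => h.notMem_link () () (hc hvc)
    have := hS (insert v c) ?_ ?_ (Finset.insert_nonempty v c)
    · rw [Finset.card_insert_of_notMem hvc] at this
      lia
    · rw [Finset.coe_insert]
      exact Set.insert_subset hv (hc.trans (h.link_subset' ()))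
    · rw [Finset.coe_insert]
      exact hc'.insert fun b hb _ => (hc hb).2.symm.imp le_of_lt le_of_lt

lemma card_le_of_chainDim_le {S : Set P} {k : ℕ} (h : chainDim S ≤ k) (c : Finset P)
    (hcS : ↑c ⊆ S) (hc : IsChain (· ≤ ·) (c : Set P)) : c.card ≤ k + 1 := by
  have := Fintype.ofFinite P
  rcases Nat.eq_zero_or_pos c.card with h0 | h0
  · lia
  obtain ⟨n, hn⟩ := Nat.exists_eq_succ_of_ne_zero h0.ne'
  have hbdd : BddAbove ({-1} ∪ {d : ℤ | ∃ n : ℕ, d = n ∧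
      ∃ f : Fin (n + 1) → P, StrictMono f ∧ ∀ i, f i ∈ S}) := by
    refine ⟨Fintype.card P, ?_⟩
    rintro d (rfl | ⟨m, rfl, f, hf, -⟩)
    · lia
    · have := Fintype.card_le_of_injective f hf.injective
      rw [Fintype.card_fin] at this
      lia
  have hle : (n : ℤ) ≤ chainDim S := by
    refine le_csSup hbdd (.inr ⟨n, rfl, ?_⟩)
    classical
    let := hc.linearOrder
    let e : Fin (n + 1) ≃o (c : Set P) := monoEquivOfFin _ (by simpa using hn)
    exact ⟨fun i => e i, fun i i' h => e.strictMono h, fun i => hcS (e i).2⟩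
  lia

/-- Maps from order complexes of small dimension to a highly connected space are nullhomotopic. -/
lemma exists_nullhomotopy {k : ℕ} (hA : ∀ j ≤ k + 1, HasExtension (Cube.boundary (Fin j)) A)
    {S : Set P} (hS : chainDim S ≤ k) (f : C(ΔSp S, A)) (x₀ : A) :
    ∃ H : C(ΔSp S × I, A), (∀ x, H (x, 0) = f x) ∧ ∀ x, H (x, 1) = x₀ := by
  classical
  have c0 : IsClosed {q : ΔSp S × (Fin 1 → I) | q.2 0 = 0} :=
    isClosed_eq (by fun_prop) continuous_const
  have c1 : IsClosed {q : ΔSp S × (Fin 1 → I) | q.2 0 = 1} :=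
    isClosed_eq (by fun_prop) continuous_const
  obtain ⟨F, hF⟩ := hasExtension_orderComplex hA S 1
    (fun c hc hc' _ => by have := card_le_of_chainDim_le hS c hc hc'; lia)
    (fun q => if q.2 0 = 0 then f q.1 else x₀) (by
      refine ContinuousOn.mono (ContinuousOn.union_of_isClosed ?_ ?_ c0 c1) ?_
      · exact ContinuousOn.congr (f := fun q : ΔSp S × (Fin 1 → I) => f q.1)
          (Continuous.continuousOn (by fun_prop)) fun q (hq : q.2 0 = 0) => if_pos hq
      · refine ContinuousOn.congr (f := fun _ => x₀) continuousOn_const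
          fun q (hq : q.2 0 = 1) => if_neg ?_
        rw [hq]
        exact one_ne_zero
      · rintro ⟨x, z⟩ ⟨-, i, hi⟩
        obtain rfl := Subsingleton.elim i 0
        exact hi)
  refine ⟨F.comp ⟨fun q => (q.1, fun _ => q.2), by fun_prop⟩, fun x => ?_, fun x => ?_⟩
  · exact (hF ⟨trivial, 0, .inl rfl⟩).trans (if_pos rfl)
  · exact (hF ⟨trivial, 0, .inr rfl⟩).trans (if_neg one_ne_zero)

end ConeExtension

open scoped Topology in
/-- Let `P` be a finite poset, `M ⊆ P` an antichain and `k ≥ 0`. If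
`dim(ΔP_{<m} * ΔP_{>m}) = dim ΔP_{<m} + dim ΔP_{>m} + 1 ≤ k` for all `m ∈ M`, and `ΔP_{∉M}` is
`k`-connected (`π₀ = … = π_k = 0`), then `ΔP ≃ ΔP_{∉M} ∨ ⋁_{m ∈ M} Σ(ΔP_{<m} * ΔP_{>m})`. -/
theorem orderComplex_homotopyEquiv_wedge_of_kConnected
    (P : Type) [PartialOrder P] [Finite P] (M : Set P) (k : ℕ)
    (hM : IsAntichain (· ≤ ·) M)
    (hdim : ∀ m ∈ M,
      chainDim (Set.Iio m ∪ Set.Ioi m) = chainDim (Set.Iio m) + chainDim (Set.Ioi m) + 1 ∧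
      chainDim (Set.Iio m ∪ Set.Ioi m) ≤ (k : ℤ))
    (hconn₀ : PathConnectedSpace (ΔSp (Mᶜ : Set P)))
    (hconn : ∀ (x : ΔSp (Mᶜ : Set P)) (i : ℕ), 1 ≤ i → i ≤ k →
      Subsingleton (π_ i (ΔSp (Mᶜ : Set P)) x)) :
    ∃ (x0 : ΔSp (Mᶜ : Set P))
      (pt : ∀ m : M, Susp (TopJoin (ΔSp (Set.Iio (m : P))) (ΔSp (Set.Ioi (m : P))))),
      Nonempty (ContinuousMap.HomotopyEquiv (ΔSp (Set.univ : Set P))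
        (Wedge (ΔSp (Mᶜ : Set P))
          (BigWedge (fun m : M => Susp (TopJoin (ΔSp (Set.Iio (m : P))) (ΔSp (Set.Ioi (m : P)))))
            pt)
          x0 BigWedge.base)) := by
  classical
  have hA := hasExtension_boundary hconn
  let x₀ : ΔSp (Mᶜ : Set P) := Classical.choice hconn₀.nonempty
  have h : AntichainExtension (fun m : M => (m : P)) (Mᶜ : Set P) Set.univ
      (fun m => Set.Iio (m : P) ∪ Set.Ioi (m : P)) := by
    refine ⟨fun _ => trivial, fun m m' hm => ?_, ?_, fun m => (Set.univ_inter _).symm⟩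
    · exact hM m.2 m'.2 fun h => hm (Subtype.ext h)
    · rw [Subtype.range_coe, Set.compl_eq_univ_sdiff]
  let e (m : M) := joinHomeomorph (U := Set.Iio (m : P)) (V := Set.Ioi (m : P))
    fun _ hu _ hv => lt_trans hu hv
  choose H H0 H1 using fun m : M =>
    exists_nullhomotopy hA (hdim m m.2).2 (ΔIncl (h.link_subset m)) x₀
  obtain ⟨E⟩ := MultiCone.nonempty_homotopyEquiv (f := fun m => h.attach e m)
    (g := fun _ _ => x₀) (fun m => (H m).comp ⟨fun q => (e m q.1, q.2), by fun_prop⟩)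
    (fun m j => H0 m (e m j)) (fun m j => H1 m (e m j))
  exact ⟨x₀, fun _ => suspPole false, ⟨(h.coneHomeomorph e).symm.toHomotopyEquiv.trans
    (E.trans (SuspWedge.multiConeHomeomorph _ x₀).toHomotopyEquiv)⟩⟩
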